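/- Let n ≥ 2 be an integer and ξ a transcendental real number with w_n(ξ) ≤ 2n - 1. Then ŵ*_n(ξ) ≥ (2·w*_n(ξ)² - w*_n(ξ) - 2n + 1)/(2·w*_n(ξ)² - n·w*_n(ξ) - n). -/

import Mathlib

open Polynomial Filter

/-- Height of an integer polynomial: the maximum absolute value of its coefficients. -/
noncomputable def polyHeight (P : Polynomial ℤ) : ℝ :=
  ((P.support.sup fun i => (P.coeff i).natAbs : ℕ) : ℝ)

/-- `P` and `Q` have no common non-constant factor in `ℤ[X]`. -/
def CoprimePoly (P Q : Polynomial ℤ) : Prop :=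
  ∀ d : Polynomial ℤ, d ∣ P → d ∣ Q → d.natDegree = 0

/-- The exponent `w_n(ξ)`. -/
noncomputable def wExp (n : ℕ) (ξ : ℝ) : EReal :=
  sSup {x : EReal | ∃ w : ℝ, x = (w : EReal) ∧
    {P : Polynomial ℤ | P.natDegree ≤ n ∧ 0 < |Polynomial.aeval ξ P| ∧
      |Polynomial.aeval ξ P| ≤ (polyHeight P) ^ (-w)}.Infinite}

/-- The uniform exponent `ŵ_n(ξ)`. -/
noncomputable def whExp (n : ℕ) (ξ : ℝ) : EReal :=
  sSup {x : EReal | ∃ w : ℝ, x = (w : EReal) ∧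
    ∀ᶠ H : ℝ in atTop, ∃ P : Polynomial ℤ, P.natDegree ≤ n ∧ polyHeight P ≤ H ∧
      0 < |Polynomial.aeval ξ P| ∧ |Polynomial.aeval ξ P| ≤ H ^ (-w)}

/-- The exponent `w*_n(ξ)` of approximation by algebraic numbers of degree at most `n`;
the height of an algebraic number is the height of its irreducible defining polynomial. -/
noncomputable def wStarExp (n : ℕ) (ξ : ℝ) : EReal :=
  sSup {x : EReal | ∃ w : ℝ, x = (w : EReal) ∧
    {α : ℝ | ∃ P : Polynomial ℤ, Irreducible P ∧ Polynomial.aeval α P = 0 ∧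
      P.natDegree ≤ n ∧ 0 < |ξ - α| ∧ |ξ - α| ≤ (polyHeight P) ^ (-w - 1)}.Infinite}

/-- The uniform exponent `ŵ*_n(ξ)`. -/
noncomputable def whStarExp (n : ℕ) (ξ : ℝ) : EReal :=
  sSup {x : EReal | ∃ w : ℝ, x = (w : EReal) ∧
    ∀ᶠ H : ℝ in atTop, ∃ α : ℝ, ∃ P : Polynomial ℤ, Irreducible P ∧
      Polynomial.aeval α P = 0 ∧ P.natDegree ≤ n ∧ polyHeight P ≤ H ∧
      0 < |ξ - α| ∧ |ξ - α| ≤ (polyHeight P)⁻¹ * H ^ (-w)}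

/-- The Mahler measure of an integer polynomial. -/
noncomputable def intMahler (P : ℤ[X]) : ℝ := (P.map (Int.castRingHom ℂ)).mahlerMeasure

lemma polyHeight_nonneg (P : ℤ[X]) : 0 ≤ polyHeight P := Nat.cast_nonneg _

lemma abs_coeff_le_polyHeight (P : ℤ[X]) (i : ℕ) : |(P.coeff i : ℝ)| ≤ polyHeight P := by
  by_cases hi : i ∈ P.support
  · have h : (P.coeff i).natAbs ≤ P.support.sup fun i => (P.coeff i).natAbs :=
      Finset.le_sup (f := fun i => (P.coeff i).natAbs) hi
    rw [← Int.cast_abs, Int.abs_eq_natAbs]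
    unfold polyHeight
    exact_mod_cast h
  · rw [notMem_support_iff.mp hi]
    simpa using polyHeight_nonneg P

lemma polyHeight_le {P : ℤ[X]} {B : ℝ} (hB : 0 ≤ B) (h : ∀ i, |(P.coeff i : ℝ)| ≤ B) :
    polyHeight P ≤ B := by
  unfold polyHeight
  rw [← Nat.le_floor_iff hB]
  refine Finset.sup_le fun i _ => Nat.le_floor ?_
  have := h i
  rwa [← Int.cast_abs, Int.abs_eq_natAbs, Int.cast_natCast] at this

lemma one_le_polyHeight {P : ℤ[X]} (hP : P ≠ 0) : 1 ≤ polyHeight P := by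
  refine le_trans ?_ (abs_coeff_le_polyHeight P P.natDegree)
  rw [← Int.cast_abs]
  exact_mod_cast Int.one_le_abs (leadingCoeff_ne_zero.mpr hP)

lemma intMahler_mul (P Q : ℤ[X]) : intMahler (P * Q) = intMahler P * intMahler Q := by
  simp [intMahler, Polynomial.map_mul, mahlerMeasure_mul]

lemma one_le_intMahler {P : ℤ[X]} (hP : P ≠ 0) : 1 ≤ intMahler P :=
  one_le_mahlerMeasure_of_ne_zero hP

lemma intMahler_le_polyHeight {n : ℕ} {P : ℤ[X]} (hP : P.natDegree ≤ n) :
    intMahler P ≤ (n + 1) * polyHeight P := by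
  refine (mahlerMeasure_le_sum_norm_coeff _).trans ?_
  rw [Polynomial.sum_over_range' _ (fun _ => norm_zero) (n + 1)
    (Nat.lt_succ_of_le (natDegree_map_le.trans hP))]
  refine (Finset.sum_le_card_nsmul _ _ (polyHeight P) fun i _ => ?_).trans ?_
  · simpa using abs_coeff_le_polyHeight P i
  · simp

lemma polyHeight_le_intMahler {n : ℕ} {P : ℤ[X]} (hP : P.natDegree ≤ n) :
    polyHeight P ≤ 2 ^ n * intMahler P := by
  have h0 : 0 ≤ intMahler P := mahlerMeasure_nonneg _
  refine polyHeight_le (by positivity) fun i => ?_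
  have h := norm_coeff_le_choose_mul_mahlerMeasure i (P.map (Int.castRingHom ℂ))
  have h1 : ‖(P.map (Int.castRingHom ℂ)).coeff i‖ = |(P.coeff i : ℝ)| := by simp
  rw [h1] at h
  refine h.trans (mul_le_mul_of_nonneg_right ?_ h0)
  exact_mod_cast (Nat.choose_le_two_pow _ _).trans
    (Nat.pow_le_pow_right (by norm_num) (natDegree_map_le.trans hP))

lemma intMahler_le_of_dvd {P Q : ℤ[X]} (hP : P ≠ 0) (h : Q ∣ P) : intMahler Q ≤ intMahler P := by
  obtain ⟨R, rfl⟩ := h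
  rw [intMahler_mul]
  exact le_mul_of_one_le_right (mahlerMeasure_nonneg _) (one_le_intMahler (right_ne_zero_of_mul hP))

lemma polyHeight_le_of_dvd {n : ℕ} {P Q : ℤ[X]} (hP : P ≠ 0) (hn : P.natDegree ≤ n) (h : Q ∣ P) :
    polyHeight Q ≤ 2 ^ n * (n + 1) * polyHeight P := by
  calc polyHeight Q ≤ 2 ^ n * intMahler Q :=
        polyHeight_le_intMahler ((natDegree_le_of_dvd h hP).trans hn)
    _ ≤ 2 ^ n * ((n + 1) * polyHeight P) := by
        gcongr
        exact (intMahler_le_of_dvd hP h).trans (intMahler_le_polyHeight hn)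
    _ = _ := by ring

lemma finite_polyHeight_le (n : ℕ) (B : ℝ) :
    {P : ℤ[X] | P.natDegree ≤ n ∧ polyHeight P ≤ B}.Finite := by
  refine (finite_mahlerMeasure_le n (Real.toNNReal ((n + 1) * B))).subset fun P hP => ⟨hP.1, ?_⟩
  refine le_trans ?_ (Real.le_coe_toNNReal _)
  refine (intMahler_le_polyHeight hP.1).trans ?_
  gcongr
  exact hP.2

lemma aeval_ne_zero_of_transcendental {ξ : ℝ} (hξ : Transcendental ℚ ξ) {P : ℤ[X]} (hP : P ≠ 0) :
    aeval ξ P ≠ 0 := by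
  have hξ' : Transcendental ℤ ξ := fun h => hξ ((IsFractionRing.isAlgebraic_iff ℤ ℚ ℝ).mp h)
  exact fun h => hξ' ⟨P, hP, h⟩

lemma exists_irreducible_dvd_of_aeval_eq_zero {P : ℤ[X]} (hP : P ≠ 0) {α : ℝ}
    (h : aeval α P = 0) : ∃ Q, Irreducible Q ∧ Q ∣ P ∧ aeval α Q = 0 := by
  induction P using WfDvdMonoid.induction_on_irreducible with
  | zero => exact absurd rfl hP
  | unit u hu =>
    have := (hu.map (aeval α : ℤ[X] →ₐ[ℤ] ℝ)).ne_zero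
    exact absurd h this
  | mul a i ha hi ih =>
    rw [map_mul] at h
    rcases mul_eq_zero.mp h with h | h
    · exact ⟨i, hi, dvd_mul_right _ _, h⟩
    · obtain ⟨Q, h1, h2, h3⟩ := ih ha h
      exact ⟨Q, h1, h2.mul_left _, h3⟩

lemma aeval_eq_sum_coeff_mul {N : ℕ} {P : ℤ[X]} (h : P.natDegree < N) (x : ℝ) :
    aeval x P = ∑ i ∈ Finset.range N, (P.coeff i : ℝ) * x ^ i := by
  rw [aeval_eq_sum_range' h]
  simp

lemma aeval_derivative_eq_sum {N : ℕ} {P : ℤ[X]} (h : P.natDegree < N) (x : ℝ) :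
    aeval x (derivative P) = ∑ i ∈ Finset.range N, (P.coeff i : ℝ) * (i * x ^ (i - 1)) := by
  conv_lhs => rw [P.as_sum_range' N h]
  simp [derivative_monomial, aeval_monomial, mul_assoc]

lemma exists_abs_add_pow_sub_le (x : ℝ) (i : ℕ) :
    ∃ C : ℝ, 0 ≤ C ∧ ∀ r : ℝ, |r| ≤ 1 →
      |(x + r) ^ i - x ^ i - i * x ^ (i - 1) * r| ≤ C * r ^ 2 := by
  induction i with
  | zero => exact ⟨0, le_rfl, by simp⟩
  | succ i ih =>
    obtain ⟨C, hC, h⟩ := ih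
    refine ⟨i * |x| ^ (i - 1) + (|x| + 1) * C, by positivity, fun r hr => ?_⟩
    have h1 : (x + r) ^ (i + 1) - x ^ (i + 1) - ((i + 1 : ℕ) : ℝ) * x ^ (i + 1 - 1) * r =
        (x + r) * ((x + r) ^ i - x ^ i - i * x ^ (i - 1) * r) + i * x ^ (i - 1) * r ^ 2 := by
      rcases i with _ | i
      · simp
      · simp only [Nat.add_sub_cancel]
        push_cast
        ring
    rw [h1]
    have h2 : |x + r| ≤ |x| + 1 := (abs_add_le _ _).trans (by linarith)
    calc _ ≤ |x + r| * |(x + r) ^ i - x ^ i - i * x ^ (i - 1) * r| + i * |x| ^ (i - 1) * r ^ 2 := by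
          refine (abs_add_le _ _).trans (le_of_eq ?_)
          simp [abs_mul, abs_pow]
      _ ≤ (|x| + 1) * (C * r ^ 2) + i * |x| ^ (i - 1) * r ^ 2 := by
          gcongr
          exact h r hr
      _ = _ := by ring

lemma exists_taylor_bound (n : ℕ) (ξ : ℝ) :
    ∃ C : ℝ, 0 ≤ C ∧ ∀ P : ℤ[X], P.natDegree ≤ n → ∀ r : ℝ, |r| ≤ 1 →
      |aeval (ξ + r) P - aeval ξ P - aeval ξ (derivative P) * r| ≤ C * polyHeight P * r ^ 2 := by
  choose C hC h using exists_abs_add_pow_sub_le ξ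
  refine ⟨∑ i ∈ Finset.range (n + 1), C i, Finset.sum_nonneg fun i _ => hC i, fun P hP r hr => ?_⟩
  have hP' := Nat.lt_succ_of_le hP
  rw [aeval_eq_sum_coeff_mul hP', aeval_eq_sum_coeff_mul hP', aeval_derivative_eq_sum hP',
    Finset.sum_mul, ← Finset.sum_sub_distrib, ← Finset.sum_sub_distrib, Finset.sum_mul,
    Finset.sum_mul]
  refine (Finset.abs_sum_le_sum_abs _ _).trans (Finset.sum_le_sum fun i _ => ?_)
  rw [← mul_sub, mul_assoc, ← mul_sub, abs_mul]
  calc _ ≤ polyHeight P * (C i * r ^ 2) :=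
        mul_le_mul (abs_coeff_le_polyHeight P i) (h i r hr) (abs_nonneg _) (polyHeight_nonneg P)
    _ = _ := by ring

lemma exists_root_of_taylor_bound {P : ℤ[X]} {ξ C K : ℝ}
    (hT : ∀ r : ℝ, |r| ≤ 1 →
      |aeval (ξ + r) P - aeval ξ P - aeval ξ (derivative P) * r| ≤ C * r ^ 2)
    (hD : 0 < |aeval ξ (derivative P)|) (hK : C ≤ K * |aeval ξ (derivative P)|) {r : ℝ}
    (hr : r * |aeval ξ (derivative P)| = 2 * |aeval ξ P|) (hr1 : r ≤ 1) (hrK : 2 * r * K ≤ 1) :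
    ∃ α : ℝ, aeval α P = 0 ∧ |ξ - α| ≤ r := by
  set D := aeval ξ (derivative P) with hDdef
  have hr0 : 0 ≤ r := by
    by_contra! h
    have := mul_neg_of_neg_of_pos h hD
    have := abs_nonneg (aeval ξ P)
    linarith
  have hE : C * r ^ 2 ≤ |aeval ξ P| := by
    calc C * r ^ 2 ≤ K * |D| * r ^ 2 := by gcongr
      _ = (2 * r * K) * (r * |D|) / 2 := by ring
      _ ≤ 1 * (r * |D|) / 2 := by gcongr
      _ = |aeval ξ P| := by rw [hr]; ring
  have h1 := abs_le.mp (hT r (by rwa [abs_of_nonneg hr0]))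
  have h2 := abs_le.mp (hT (-r) (by rwa [abs_neg, abs_of_nonneg hr0]))
  rw [neg_sq] at h2
  have h3 := abs_le.mp (le_refl |aeval ξ P|)
  have h0 : (0 : ℝ) ∈ Set.uIcc (aeval (ξ + -r) P) (aeval (ξ + r) P) := by
    rw [Set.mem_uIcc]
    rcases abs_cases D with ⟨hd, _⟩ | ⟨hd, _⟩
    · rw [hd] at hr
      left
      constructor <;> linarith
    · rw [hd] at hr
      right
      constructor <;> linarith
  have hcont : Continuous fun x : ℝ => aeval x P := by fun_prop
  obtain ⟨α, hα, hα0⟩ := intermediate_value_uIcc hcont.continuousOn h0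
  refine ⟨α, hα0, ?_⟩
  rw [Set.uIcc_of_le (by linarith)] at hα
  rw [abs_le]
  constructor <;> linarith [hα.1, hα.2]

lemma exists_polyHeight_le_of_derivative (m : ℕ) (ξ : ℝ) :
    ∃ C : ℝ, 1 ≤ C ∧ ∀ (P : ℤ[X]) (B : ℝ), P.natDegree < m + 2 →
      (∀ i, |(P.coeff (i + 2) : ℝ)| ≤ B) → |aeval ξ (derivative P)| ≤ B → |aeval ξ P| ≤ B →
      polyHeight P ≤ C * B := by
  set S₁ := ∑ i ∈ Finset.range m, |((i + 2 : ℕ) : ℝ) * ξ ^ (i + 1)|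
  set S₀ := ∑ i ∈ Finset.range m, |ξ ^ (i + 2)|
  have hS₁ : 0 ≤ S₁ := Finset.sum_nonneg fun _ _ => abs_nonneg _
  have hS₀ : 0 ≤ S₀ := Finset.sum_nonneg fun _ _ => abs_nonneg _
  refine ⟨1 + S₁ + (1 + |ξ| * (1 + S₁) + S₀), ?_, fun P B hP hc h1 h0 => ?_⟩
  · have : 0 ≤ |ξ| * (1 + S₁) := by positivity
    linarith
  have hB : 0 ≤ B := (abs_nonneg _).trans h0
  rw [aeval_derivative_eq_sum hP, Finset.sum_range_succ', Finset.sum_range_succ'] at h1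
  rw [aeval_eq_sum_coeff_mul hP, Finset.sum_range_succ', Finset.sum_range_succ'] at h0
  have e1 : |∑ i ∈ Finset.range m, (P.coeff (i + 2) : ℝ) * (((i + 2 : ℕ) : ℝ) * ξ ^ (i + 1))| ≤
      S₁ * B := by
    refine (Finset.abs_sum_le_sum_abs _ _).trans ?_
    rw [Finset.sum_mul]
    refine Finset.sum_le_sum fun i _ => ?_
    rw [abs_mul, mul_comm]
    exact mul_le_mul_of_nonneg_left (hc i) (abs_nonneg _)
  have e0 : |∑ i ∈ Finset.range m, (P.coeff (i + 2) : ℝ) * ξ ^ (i + 2)| ≤ S₀ * B := by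
    refine (Finset.abs_sum_le_sum_abs _ _).trans ?_
    rw [Finset.sum_mul]
    refine Finset.sum_le_sum fun i _ => ?_
    rw [abs_mul, mul_comm]
    exact mul_le_mul_of_nonneg_left (hc i) (abs_nonneg _)
  have c1 : |(P.coeff 1 : ℝ)| ≤ (1 + S₁) * B := by
    have h1' : |∑ i ∈ Finset.range m, (P.coeff (i + 2) : ℝ) * (((i + 2 : ℕ) : ℝ) * ξ ^ (i + 1)) +
        (P.coeff 1 : ℝ)| ≤ B := by simpa [add_assoc] using h1
    rw [abs_le] at *
    constructor <;> linarith
  have c0 : |(P.coeff 0 : ℝ)| ≤ (1 + |ξ| * (1 + S₁) + S₀) * B := by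
    have h0' : |∑ i ∈ Finset.range m, (P.coeff (i + 2) : ℝ) * ξ ^ (i + 2) +
        (P.coeff 1 : ℝ) * ξ + (P.coeff 0 : ℝ)| ≤ B := by simpa [add_assoc] using h0
    have c1' : |(P.coeff 1 : ℝ) * ξ| ≤ |ξ| * (1 + S₁) * B := by
      rw [abs_mul, mul_comm, mul_assoc]
      gcongr
    rw [abs_le] at h0' c1' e0 ⊢
    constructor <;> linarith
  have n1 : 0 ≤ |ξ| * (1 + S₁) * B := by positivity
  have n2 : 0 ≤ S₁ * B := by positivity
  have n3 : 0 ≤ S₀ * B := by positivity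
  refine polyHeight_le (by nlinarith) fun i => ?_
  rcases i with _ | _ | i
  · linarith
  · simp only [zero_add] at c1 ⊢
    linarith
  · refine (hc i).trans ?_
    linarith

lemma exists_small_values (n N J K : ℕ) (hn : 2 ≤ n) (ξ : ℝ) (hK : 0 < K)
    (hlt : K < (N + 1) ^ (n - 1) * J) :
    ∃ P : ℤ[X], P ≠ 0 ∧ P.natDegree ≤ n ∧ (∀ i, |(P.coeff (i + 2) : ℝ)| ≤ N) ∧
      |aeval ξ (derivative P)| ≤ J ∧ |aeval ξ P| ≤ (K : ℝ)⁻¹ := by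
  let t : (Fin (n - 1) → Fin (N + 1)) → ℤ[X] := fun a =>
    ∑ i : Fin (n - 1), monomial ((i : ℕ) + 2) ((a i : ℕ) : ℤ)
  let b : (Fin (n - 1) → Fin (N + 1)) × Fin J → ℤ := fun p =>
    ((p.2 : ℕ) : ℤ) - ⌊aeval ξ (derivative (t p.1))⌋
  let F : (Fin (n - 1) → Fin (N + 1)) × Fin J → ℤ[X] := fun p =>
    t p.1 + C (b p) * X - C ⌊aeval ξ (t p.1) + b p * ξ⌋
  have hF0 : ∀ p, aeval ξ (F p) = Int.fract (aeval ξ (t p.1) + b p * ξ) := fun p => by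
    simp only [F, map_sub, map_add, map_mul, aeval_C, aeval_X]
    exact Int.self_sub_floor _
  have hF1 : ∀ p, aeval ξ (derivative (F p)) =
      Int.fract (aeval ξ (derivative (t p.1))) + (p.2 : ℕ) := fun p => by
    simp only [F, b, ← Int.self_sub_floor, map_sub, map_add, derivative_mul, derivative_C,
      derivative_X, zero_mul, mul_one, zero_add, sub_zero, aeval_C]
    simp only [eq_intCast, Int.cast_natCast]
    ring
  have htc : ∀ a (j : ℕ), (t a).coeff j =
      ∑ i : Fin (n - 1), if (i : ℕ) + 2 = j then ((a i : ℕ) : ℤ) else 0 := fun a j => by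
    simp [t, coeff_monomial]
  have hFc : ∀ p (i : ℕ), (F p).coeff (i + 2) = (t p.1).coeff (i + 2) := fun p i => by
    simp only [F, coeff_sub, coeff_add, coeff_C_mul, coeff_X, coeff_C]
    simp
  have hFi : ∀ p (i : Fin (n - 1)), (F p).coeff ((i : ℕ) + 2) = ((p.1 i : ℕ) : ℤ) := fun p i => by
    rw [hFc, htc, Finset.sum_eq_single i]
    · simp
    · intro k _ hk
      rw [if_neg]
      intro h
      exact hk (Fin.ext (by omega))
    · simp
  have hFz : ∀ p (i : ℕ), n - 1 ≤ i → (F p).coeff (i + 2) = 0 := fun p i hi => by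
    rw [hFc, htc]
    refine Finset.sum_eq_zero fun k _ => if_neg ?_
    have := k.2
    omega
  have hF1c : ∀ p, (F p).coeff 1 = b p := fun p => by
    have : (t p.1).coeff 1 = 0 := by
      rw [htc]
      exact Finset.sum_eq_zero fun k _ => if_neg (by omega)
    simp only [F, this, coeff_sub, coeff_add, coeff_C_mul, coeff_X, coeff_C]
    simp
  have hinj : Function.Injective F := by
    rintro ⟨a, j⟩ ⟨a', j'⟩ h
    have ha : a = a' := by
      funext i
      have h1 := hFi (a, j) i
      rw [h, hFi] at h1
      exact Fin.ext (by exact_mod_cast h1.symm)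
    subst ha
    have h2 := hF1c (a, j)
    rw [h, hF1c] at h2
    simp only [b, sub_left_inj] at h2
    exact Prod.ext rfl (Fin.ext (by exact_mod_cast h2.symm))
  have hK' : (0 : ℝ) < K := by exact_mod_cast hK
  obtain ⟨p, -, q, -, hpq, hbox⟩ := Finset.exists_ne_map_eq_of_card_lt_of_maps_to
    (s := Finset.univ) (t := Finset.Ico (0 : ℤ) K) (f := fun p => ⌊(K : ℝ) * aeval ξ (F p)⌋)
    (by simpa [Finset.card_univ] using hlt) (by
      intro p _
      rw [Finset.mem_coe, Finset.mem_Ico, Int.le_floor, Int.floor_lt, hF0]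
      constructor
      · simpa using mul_nonneg hK'.le (Int.fract_nonneg _)
      · simpa using mul_lt_mul_of_pos_left (Int.fract_lt_one (aeval ξ (t p.1) + b p * ξ)) hK')
  refine ⟨F p - F q, sub_ne_zero.mpr fun h => hpq (hinj h), ?_, fun i => ?_, ?_, ?_⟩
  · rw [natDegree_le_iff_coeff_eq_zero]
    intro j hj
    obtain ⟨i, rfl⟩ : ∃ i, j = i + 2 := ⟨j - 2, by omega⟩
    rw [coeff_sub, hFz p i (by omega), hFz q i (by omega), sub_zero]
  · by_cases hi : i < n - 1
    · have hp := hFi p ⟨i, hi⟩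
      have hq := hFi q ⟨i, hi⟩
      simp only at hp hq
      rw [coeff_sub, hp, hq]
      have h1 := (p.1 ⟨i, hi⟩).2
      have h2 := (q.1 ⟨i, hi⟩).2
      have h3 : |(((p.1 ⟨i, hi⟩ : ℕ) : ℤ) - ((q.1 ⟨i, hi⟩ : ℕ) : ℤ))| ≤ (N : ℤ) := by
        rw [abs_le]
        omega
      exact_mod_cast h3
    · rw [coeff_sub, hFz p i (by omega), hFz q i (by omega)]
      simp
  · rw [derivative_sub, map_sub, hF1, hF1]
    have h1 : ((p.2 : ℕ) : ℝ) + 1 ≤ J := by exact_mod_cast p.2.2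
    have h2 : ((q.2 : ℕ) : ℝ) + 1 ≤ J := by exact_mod_cast q.2.2
    have h3 : (0 : ℝ) ≤ ((p.2 : ℕ) : ℝ) := Nat.cast_nonneg _
    have h4 : (0 : ℝ) ≤ ((q.2 : ℕ) : ℝ) := Nat.cast_nonneg _
    have h5 := Int.fract_nonneg (aeval ξ (derivative (t p.1)))
    have h6 := Int.fract_nonneg (aeval ξ (derivative (t q.1)))
    have h7 := Int.fract_lt_one (aeval ξ (derivative (t p.1)))
    have h8 := Int.fract_lt_one (aeval ξ (derivative (t q.1)))
    rw [abs_le]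
    constructor <;> linarith
  · have h := (Int.abs_sub_lt_one_of_floor_eq_floor hbox).le
    rw [← mul_sub, abs_mul, abs_of_pos hK'] at h
    rw [map_sub]
    rwa [← one_div, le_div_iff₀' hK']

lemma exists_algebraic_approximation {n : ℕ} (hn : 2 ≤ n) (ξ : ℝ) {w : ℝ} (hw : (n : ℝ) - 1 < w) :
    ∃ C : ℝ, 1 ≤ C ∧ ∀ᶠ H : ℝ in atTop,
      (∀ P : ℤ[X], P ≠ 0 → P.natDegree ≤ n → polyHeight P ≤ C * H → H ^ (-w) < |aeval ξ P|) →
      ∃ (α : ℝ) (Q : ℤ[X]), Irreducible Q ∧ aeval α Q = 0 ∧ Q.natDegree ≤ n ∧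
        polyHeight Q ≤ C * H ^ (w - n + 1) ∧ |ξ - α| ≤ C * (polyHeight Q)⁻¹ * H ^ (-w) := by
  obtain ⟨C₀, hC₀, hH⟩ := exists_polyHeight_le_of_derivative (n - 1) ξ
  obtain ⟨T, hT, hTay⟩ := exists_taylor_bound n ξ
  set E : ℝ := 2 ^ n * (n + 1) * C₀ with hE
  have hE1 : C₀ ≤ E := by
    have h1 : (1 : ℝ) ≤ 2 ^ n := one_le_pow₀ (by norm_num)
    have h2 : (1 : ℝ) ≤ n + 1 := by linarith [(Nat.cast_nonneg n : (0 : ℝ) ≤ n)]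
    have h3 : 1 ≤ (2 : ℝ) ^ n * (n + 1) := one_le_mul_of_one_le_of_one_le h1 h2
    rw [hE]
    nlinarith
  refine ⟨3 * E, by linarith, ?_⟩
  filter_upwards [eventually_ge_atTop (2 : ℝ), eventually_ge_atTop (4 * (T * C₀))]
    with H hH2 hHT hno
  have hH0 : 0 < H := by linarith
  have hH1 : 1 ≤ H := by linarith
  have hnw : 0 < w := by
    have : (2 : ℝ) ≤ n := by exact_mod_cast hn
    linarith
  have hHw : 0 < H ^ w := Real.rpow_pos_of_pos hH0 _
  have hg1 : 1 ≤ H ^ (w - n + 1) := Real.one_le_rpow hH1 (by linarith)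
  have hlt : ⌈H ^ w⌉₊ < (⌊H⌋₊ + 1) ^ (n - 1) * (⌈H ^ (w - n + 1)⌉₊ + 1) := by
    have h1 : (⌈H ^ w⌉₊ : ℝ) < H ^ w + 1 := Nat.ceil_lt_add_one hHw.le
    have h2 : H ^ (n - 1) ≤ ((⌊H⌋₊ : ℝ) + 1) ^ (n - 1) := by
      gcongr
      exact (Nat.lt_floor_add_one H).le
    have h3 : H ^ w = H ^ (n - 1) * H ^ (w - n + 1) := by
      rw [← Real.rpow_natCast, ← Real.rpow_add hH0, Nat.cast_sub (by omega)]
      congr 1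
      push_cast
      ring
    have h4 : (1 : ℝ) ≤ H ^ (n - 1) := one_le_pow₀ hH1
    have h5 : H ^ (n - 1) * (H ^ (w - n + 1) + 1) ≤
        ((⌊H⌋₊ : ℝ) + 1) ^ (n - 1) * ((⌈H ^ (w - n + 1)⌉₊ : ℝ) + 1) := by
      gcongr
      exact Nat.le_ceil _
    have h6 : (⌈H ^ w⌉₊ : ℝ) < ((⌊H⌋₊ : ℝ) + 1) ^ (n - 1) * ((⌈H ^ (w - n + 1)⌉₊ : ℝ) + 1) := by
      linarith
    exact_mod_cast h6
  obtain ⟨P, hP0, hPn, hPc, hP1, hPv⟩ := exists_small_values n ⌊H⌋₊ (⌈H ^ (w - n + 1)⌉₊ + 1)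
    ⌈H ^ w⌉₊ hn ξ (Nat.ceil_pos.mpr hHw) hlt
  have hPv' : |aeval ξ P| ≤ H ^ (-w) := by
    rw [Real.rpow_neg hH0.le]
    exact hPv.trans (inv_anti₀ hHw (Nat.le_ceil _))
  have hPv1 : |aeval ξ P| ≤ 1 := hPv'.trans (Real.rpow_le_one_of_one_le_of_nonpos hH1 (by linarith))
  have hNH : (⌊H⌋₊ : ℝ) ≤ H := Nat.floor_le hH0.le
  have hPn' : P.natDegree < n - 1 + 2 := by omega
  have hD : H < |aeval ξ (derivative P)| := by
    by_contra! hcon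
    have h := hH P H hPn' (fun i => (hPc i).trans hNH) hcon (hPv1.trans hH1)
    refine absurd (hno P hP0 hPn (h.trans ?_)) (not_lt.mpr hPv')
    gcongr
    linarith
  set D := |aeval ξ (derivative P)| with hDdef
  have hD0 : 0 < D := hH0.trans hD
  have hPD : polyHeight P ≤ C₀ * D :=
    hH P D hPn' (fun i => (hPc i).trans (hNH.trans hD.le)) le_rfl (by linarith)
  have hr2 : 2 * |aeval ξ P| / D ≤ 2 / H := by
    apply div_le_div₀ <;> linarith
  obtain ⟨α, hα, hξα⟩ := exists_root_of_taylor_bound (P := P) (ξ := ξ) (C := T * polyHeight P)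
    (K := T * C₀) (r := 2 * |aeval ξ P| / D) (fun r hr => hTay P hPn r hr) hD0
    (by rw [mul_assoc]; gcongr) (by rw [← hDdef]; field_simp)
    (hr2.trans (by rw [div_le_one hH0]; exact hH2))
    (by
      calc 2 * (2 * |aeval ξ P| / D) * (T * C₀) ≤ 2 * (2 / H) * (T * C₀) := by gcongr
        _ = 4 * (T * C₀) / H := by ring
        _ ≤ 1 := by rwa [div_le_one hH0])
  obtain ⟨Q, hQ, hQP, hQα⟩ := exists_irreducible_dvd_of_aeval_eq_zero hP0 hα
  have hQD : polyHeight Q ≤ E * D := by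
    refine (polyHeight_le_of_dvd hP0 hPn hQP).trans ?_
    rw [hE, mul_assoc _ C₀]
    gcongr
  have hQ1 := one_le_polyHeight hQ.ne_zero
  have hE0 : 0 < E := by linarith
  refine ⟨α, Q, hQ, hQα, (natDegree_le_of_dvd hQP hP0).trans hPn, hQD.trans ?_, hξα.trans ?_⟩
  · have h1 : D ≤ 3 * H ^ (w - n + 1) := by
      have := Nat.ceil_lt_add_one (zero_le_one.trans hg1)
      push_cast at hP1
      linarith
    calc E * D ≤ E * (3 * H ^ (w - n + 1)) := by gcongr
      _ = _ := by ring
  · have h1 : D⁻¹ ≤ E * (polyHeight Q)⁻¹ := by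
      rw [← div_eq_mul_inv, inv_le_iff_one_le_mul₀ hD0, div_mul_eq_mul_div,
        le_div_iff₀ (by linarith)]
      linarith
    have h2 : 0 < H ^ (-w) := Real.rpow_pos_of_pos hH0 _
    have h3 : 0 ≤ E * (polyHeight Q)⁻¹ := by positivity
    calc 2 * |aeval ξ P| / D = 2 * (|aeval ξ P| * D⁻¹) := by ring
      _ ≤ 2 * (H ^ (-w) * (E * (polyHeight Q)⁻¹)) := by gcongr
      _ ≤ 3 * (H ^ (-w) * (E * (polyHeight Q)⁻¹)) := by
        gcongr
        norm_num
      _ = _ := by ring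

lemma abs_sub_pos_of_transcendental {ξ α : ℝ} (hξ : Transcendental ℚ ξ) {Q : ℤ[X]} (hQ : Q ≠ 0)
    (hα : aeval α Q = 0) : 0 < |ξ - α| := by
  rw [abs_pos, sub_ne_zero]
  rintro rfl
  exact aeval_ne_zero_of_transcendental hξ hQ hα

/-- If polynomial approximation to the exponent `w` fails eventually, then approximation by
algebraic numbers to every uniform exponent below `w / (w - n + 1)` is possible. -/
lemma eventually_algebraic_approximation {n : ℕ} (hn : 2 ≤ n) {ξ : ℝ} (hξ : Transcendental ℚ ξ)
    {w s : ℝ} (hw : (n : ℝ) - 1 < w)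
    (hfin : {P : ℤ[X] | P.natDegree ≤ n ∧ 0 < |aeval ξ P| ∧
      |aeval ξ P| ≤ (polyHeight P) ^ (-w)}.Finite) (hs : s * (w - n + 1) < w) :
    ∀ᶠ H : ℝ in atTop, ∃ α : ℝ, ∃ P : ℤ[X], Irreducible P ∧
      aeval α P = 0 ∧ P.natDegree ≤ n ∧ polyHeight P ≤ H ∧
      0 < |ξ - α| ∧ |ξ - α| ≤ (polyHeight P)⁻¹ * H ^ (-s) := by
  obtain ⟨w', hww', hsw'⟩ : ∃ w', w < w' ∧ s * (w' - n + 1) < w' := by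
    have hc : Continuous fun x : ℝ => x - s * (x - n + 1) := by fun_prop
    have h1 : ∀ᶠ x in nhds w, 0 < x - s * (x - n + 1) :=
      hc.continuousAt.eventually (lt_mem_nhds (by linarith))
    obtain ⟨x, hx, hx'⟩ := ((h1.filter_mono nhdsWithin_le_nhds).and
      (self_mem_nhdsWithin (s := Set.Ioi w))).exists
    exact ⟨x, hx', by linarith⟩
  have hw' : (n : ℝ) - 1 < w' := hw.trans hww'
  have hn2 : (2 : ℝ) ≤ n := by exact_mod_cast hn
  obtain ⟨C, hC, hev⟩ := exists_algebraic_approximation hn ξ hw'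
  have hg : 0 < w' - n + 1 := by linarith
  have hC0 : 0 < C := by linarith
  obtain ⟨δ, hδ, hδP⟩ : ∃ δ > 0, ∀ P ∈ {P : ℤ[X] | P.natDegree ≤ n ∧ 0 < |aeval ξ P| ∧
      |aeval ξ P| ≤ (polyHeight P) ^ (-w)}, δ < |aeval ξ P| := by
    have h1 : ∀ P ∈ {P : ℤ[X] | P.natDegree ≤ n ∧ 0 < |aeval ξ P| ∧
      |aeval ξ P| ≤ (polyHeight P) ^ (-w)}, ∀ᶠ δ in nhdsWithin (0 : ℝ) (Set.Ioi 0),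
        δ < |aeval ξ P| := fun P hP =>
      (gt_mem_nhds hP.2.1).filter_mono nhdsWithin_le_nhds
    obtain ⟨δ, h, h'⟩ := (((Set.Finite.eventually_all hfin).mpr h1).and self_mem_nhdsWithin).exists
    exact ⟨δ, h', h⟩
  have hsmall : ∀ᶠ h : ℝ in atTop, h ^ (-w') < δ :=
    (tendsto_rpow_neg_atTop (by linarith : 0 < w')).eventually (gt_mem_nhds hδ)
  have hlarge : ∀ᶠ h : ℝ in atTop, C ^ w ≤ h ^ (w' - w) :=
    (tendsto_rpow_atTop (by linarith : 0 < w' - w)).eventually_ge_atTop _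
  have hlarge2 : ∀ᶠ h : ℝ in atTop, C * C ^ s ≤ h ^ (w' - s * (w' - n + 1)) :=
    (tendsto_rpow_atTop (by linarith : 0 < w' - s * (w' - n + 1))).eventually_ge_atTop _
  have key := ((hev.and hsmall).and (hlarge.and (hlarge2.and (eventually_gt_atTop 0))))
  have hscale : Tendsto (fun H : ℝ => (H / C) ^ (w' - n + 1)⁻¹) atTop atTop :=
    (tendsto_rpow_atTop (inv_pos.mpr hg)).comp (tendsto_id.atTop_div_const hC0)
  filter_upwards [hscale.eventually key, eventually_gt_atTop 0] with H hH hHpos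
  set h := (H / C) ^ (w' - n + 1)⁻¹ with hh
  obtain ⟨⟨h1, h2⟩, h3, h4, h0⟩ := hH
  have hpow : C * h ^ (w' - n + 1) = H := by
    rw [hh, ← Real.rpow_mul (by positivity), inv_mul_cancel₀ hg.ne', Real.rpow_one]
    field_simp
  obtain ⟨α, Q, hQ, hα, hQn, hQh, hd⟩ := h1 fun P hP0 hPn hPh => by
    by_contra! hcon
    have hpos : 0 < |aeval ξ P| := abs_pos.mpr (aeval_ne_zero_of_transcendental hξ hP0)
    have hP1 := one_le_polyHeight hP0
    refine absurd (hδP P ⟨hPn, hpos, hcon.trans ?_⟩) (not_lt.mpr (hcon.trans h2.le))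
    calc h ^ (-w') ≤ (C * h) ^ (-w) := by
          rw [Real.mul_rpow hC0.le h0.le, Real.rpow_neg hC0.le, ← div_eq_inv_mul,
            le_div_iff₀ (by positivity)]
          calc h ^ (-w') * C ^ w ≤ h ^ (-w') * h ^ (w' - w) := by gcongr
            _ = h ^ (-w) := by
              rw [← Real.rpow_add h0]
              congr 1
              ring
      _ ≤ polyHeight P ^ (-w) :=
        Real.rpow_le_rpow_of_nonpos (by linarith) hPh (by linarith)
  have hQ1 := one_le_polyHeight hQ.ne_zero
  refine ⟨α, Q, hQ, hα, hQn, hQh.trans hpow.le, abs_sub_pos_of_transcendental hξ hQ.ne_zero hα,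
    hd.trans ?_⟩
  rw [mul_comm C, mul_assoc]
  gcongr
  rw [← hpow, Real.mul_rpow hC0.le (by positivity), ← Real.rpow_mul h0.le, Real.rpow_neg hC0.le,
    ← div_eq_inv_mul, le_div_iff₀ (by positivity)]
  calc C * h ^ (-w') * C ^ s = (C * C ^ s) * h ^ (-w') := by ring
    _ ≤ h ^ (w' - s * (w' - n + 1)) * h ^ (-w') := by gcongr
    _ = _ := by
      rw [← Real.rpow_add h0]
      congr 1
      ring

lemma infinite_of_forall_exists_abs_sub_lt {S : Set ℝ} {ξ : ℝ} (hξ : ξ ∉ S)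
    (h : ∀ ε > 0, ∃ α ∈ S, |ξ - α| < ε) : S.Infinite := by
  intro hS
  have h1 : Sᶜ ∈ nhds ξ := hS.isClosed.isOpen_compl.mem_nhds hξ
  obtain ⟨ε, hε, hball⟩ := Metric.mem_nhds_iff.mp h1
  obtain ⟨α, hα, hd⟩ := h ε hε
  refine hball (a := α) ?_ hα
  rwa [Metric.mem_ball, dist_comm, Real.dist_eq]

/-- If uniform polynomial approximation to the exponent `v` fails, then approximation by
algebraic numbers to every exponent below `v / (v - n + 1)` is possible. -/
lemma infinite_algebraic_approximation {n : ℕ} (hn : 2 ≤ n) {ξ : ℝ} (hξ : Transcendental ℚ ξ)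
    {v s : ℝ} (hv : (n : ℝ) - 1 < v) (hs0 : 0 ≤ s)
    (hno : ¬ ∀ᶠ H : ℝ in atTop, ∃ P : ℤ[X], P.natDegree ≤ n ∧ polyHeight P ≤ H ∧
      0 < |aeval ξ P| ∧ |aeval ξ P| ≤ H ^ (-v)) (hs : s * (v - n + 1) < v) :
    {α : ℝ | ∃ P : ℤ[X], Irreducible P ∧ aeval α P = 0 ∧
      P.natDegree ≤ n ∧ 0 < |ξ - α| ∧ |ξ - α| ≤ (polyHeight P) ^ (-s - 1)}.Infinite := by
  obtain ⟨w, hvw, hsw⟩ : ∃ w, v < w ∧ s * (w - n + 1) < w := by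
    have hc : Continuous fun x : ℝ => x - s * (x - n + 1) := by fun_prop
    have h1 : ∀ᶠ x in nhds v, 0 < x - s * (x - n + 1) :=
      hc.continuousAt.eventually (lt_mem_nhds (by linarith))
    obtain ⟨x, hx, hx'⟩ := ((h1.filter_mono nhdsWithin_le_nhds).and
      (self_mem_nhdsWithin (s := Set.Ioi v))).exists
    exact ⟨x, hx', by linarith⟩
  have hw : (n : ℝ) - 1 < w := hv.trans hvw
  have hn2 : (2 : ℝ) ≤ n := by exact_mod_cast hn
  have hg : 0 < w - n + 1 := by linarith
  obtain ⟨C, hC, hev⟩ := exists_algebraic_approximation hn ξ hw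
  have hC0 : 0 < C := by linarith
  refine infinite_of_forall_exists_abs_sub_lt (ξ := ξ) ?_ fun ε hε => ?_
  · rintro ⟨P, -, -, -, h, -⟩
    simp at h
  have hsmall : ∀ᶠ h : ℝ in atTop, C * h ^ (-w) < ε := by
    have h := (tendsto_rpow_neg_atTop (by linarith : 0 < w)).const_mul C
    rw [mul_zero] at h
    exact h.eventually (gt_mem_nhds hε)
  have hlarge : ∀ᶠ h : ℝ in atTop, C ^ v ≤ h ^ (w - v) :=
    (tendsto_rpow_atTop (by linarith : 0 < w - v)).eventually_ge_atTop _
  have hlarge2 : ∀ᶠ h : ℝ in atTop, C * C ^ s ≤ h ^ (w - s * (w - n + 1)) :=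
    (tendsto_rpow_atTop (by linarith : 0 < w - s * (w - n + 1))).eventually_ge_atTop _
  have key := ((hev.and hsmall).and (hlarge.and (hlarge2.and (eventually_gt_atTop 0))))
  have hscale : Tendsto (fun H : ℝ => H / C) atTop atTop := tendsto_id.atTop_div_const hC0
  obtain ⟨H, hnoH, hH⟩ :=
    ((not_eventually.mp hno).and_eventually (hscale.eventually key)).exists
  set h := H / C with hh
  obtain ⟨⟨h1, h2⟩, h3, h4, h0⟩ := hH
  have hHh : H = C * h := by
    rw [hh]
    field_simp
  obtain ⟨α, Q, hQ, hα, hQn, hQh, hd⟩ := h1 fun P hP0 hPn hPh => by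
    by_contra! hcon
    have hpos : 0 < |aeval ξ P| := abs_pos.mpr (aeval_ne_zero_of_transcendental hξ hP0)
    refine hnoH ⟨P, hPn, hPh.trans hHh.ge, hpos, hcon.trans ?_⟩
    rw [hHh, Real.mul_rpow hC0.le h0.le, Real.rpow_neg hC0.le, ← div_eq_inv_mul,
      le_div_iff₀ (by positivity)]
    calc h ^ (-w) * C ^ v ≤ h ^ (-w) * h ^ (w - v) := by gcongr
      _ = h ^ (-v) := by
        rw [← Real.rpow_add h0]
        congr 1
        ring
  have hQ1 := one_le_polyHeight hQ.ne_zero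
  have hQ0 : 0 < polyHeight Q := by linarith
  refine ⟨α, ⟨Q, hQ, hα, hQn, abs_sub_pos_of_transcendental hξ hQ.ne_zero hα, hd.trans ?_⟩, ?_⟩
  · rw [sub_eq_add_neg, Real.rpow_add hQ0, Real.rpow_neg_one, mul_comm (polyHeight Q ^ (-s)),
      mul_comm C, mul_assoc]
    gcongr
    calc C * h ^ (-w) ≤ (C * h ^ (w - n + 1)) ^ (-s) := by
          rw [Real.mul_rpow hC0.le (by positivity), ← Real.rpow_mul h0.le, Real.rpow_neg hC0.le,
            ← div_eq_inv_mul, le_div_iff₀ (by positivity)]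
          calc C * h ^ (-w) * C ^ s = (C * C ^ s) * h ^ (-w) := by ring
            _ ≤ h ^ (w - s * (w - n + 1)) * h ^ (-w) := by gcongr
            _ = _ := by
              rw [← Real.rpow_add h0]
              congr 1
              ring
      _ ≤ polyHeight Q ^ (-s) := Real.rpow_le_rpow_of_nonpos hQ0 hQh (by linarith)
  · refine lt_of_le_of_lt ?_ h2
    refine hd.trans ?_
    gcongr
    exact mul_le_of_le_one_right hC0.le (inv_le_one_of_one_le₀ hQ1)

/-- The sum of `min x y` over all pairs from two multisets. -/
noncomputable def minSum (s t : Multiset ℝ) : ℝ := (s.map fun x => (t.map fun y => min x y).sum).sum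

lemma minSum_cons_left (x : ℝ) (s t : Multiset ℝ) :
    minSum (x ::ₘ s) t = (t.map fun y => min x y).sum + minSum s t := by
  simp [minSum]

lemma minSum_comm (s t : Multiset ℝ) : minSum s t = minSum t s := by
  unfold minSum
  rw [Multiset.sum_map_sum_map]
  simp_rw [min_comm]

lemma sum_map_min_eq {x : ℝ} {t : Multiset ℝ} (h : ∀ y ∈ t, y ≤ x) :
    (t.map fun y => min x y).sum = t.sum := by
  rw [Multiset.map_congr rfl fun y hy => min_eq_right (h y hy), Multiset.map_id']

lemma minSum_nonneg {s t : Multiset ℝ} (hs : ∀ x ∈ s, 0 ≤ x) (ht : ∀ y ∈ t, 0 ≤ y) :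
    0 ≤ minSum s t := by
  refine Multiset.sum_nonneg fun z hz => ?_
  obtain ⟨x, hx, rfl⟩ := Multiset.mem_map.mp hz
  refine Multiset.sum_nonneg fun z hz => ?_
  obtain ⟨y, hy, rfl⟩ := Multiset.mem_map.mp hz
  exact le_min (hs x hx) (ht y hy)

lemma sum_le_minSum_of_mem {s t : Multiset ℝ} (hs : ∀ x ∈ s, 0 ≤ x) (ht : ∀ y ∈ t, 0 ≤ y) {x : ℝ}
    (hx : x ∈ s) (h : ∀ y ∈ t, y ≤ x) : t.sum ≤ minSum s t := by
  obtain ⟨s', rfl⟩ := Multiset.exists_cons_of_mem hx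
  rw [minSum_cons_left, sum_map_min_eq h]
  linarith [minSum_nonneg (fun x hx => hs x (Multiset.mem_cons_of_mem hx)) ht]

lemma exists_mem_forall_le {s : Multiset ℝ} (h : s ≠ 0) : ∃ x ∈ s, ∀ y ∈ s, y ≤ x := by
  obtain ⟨x, hx, hm⟩ := s.toFinset.exists_max_image id (by simpa using h)
  exact ⟨x, by simpa using hx, fun y hy => hm y (by simpa using hy)⟩

lemma min_sum_le_minSum {s t : Multiset ℝ} (hs : ∀ x ∈ s, 0 ≤ x) (ht : ∀ y ∈ t, 0 ≤ y) :
    min s.sum t.sum ≤ minSum s t := by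
  rcases eq_or_ne s 0 with rfl | hs0
  · exact (min_le_left _ _).trans (by simp [minSum])
  rcases eq_or_ne t 0 with rfl | ht0
  · exact (min_le_right _ _).trans (by simp [minSum])
  obtain ⟨x, hx, hxm⟩ := exists_mem_forall_le hs0
  obtain ⟨y, hy, hym⟩ := exists_mem_forall_le ht0
  rcases le_total y x with h | h
  · exact (min_le_right _ _).trans (sum_le_minSum_of_mem hs ht hx fun z hz => (hym z hz).trans h)
  · rw [minSum_comm]
    exact (min_le_left _ _).trans (sum_le_minSum_of_mem ht hs hy fun z hz => (hxm z hz).trans h)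

lemma minSum_cons_cons_cases {x y : ℝ} {s t : Multiset ℝ} (hs : ∀ z ∈ x ::ₘ s, 0 ≤ z)
    (ht : ∀ z ∈ y ::ₘ t, 0 ≤ z) (hyt : ∀ z ∈ t, z ≤ y) (hyx : y ≤ x) :
    2 * (y ::ₘ t).sum ≤ minSum (x ::ₘ s) (y ::ₘ t) ∨
      (x ∉ s ∧ (∀ z ∈ s, z ≤ y) ∧
        (y ::ₘ t).sum + s.sum + minSum s t = minSum (x ::ₘ s) (y ::ₘ t)) := by
  have hs' : ∀ z ∈ s, 0 ≤ z := fun z hz => hs z (Multiset.mem_cons_of_mem hz)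
  have hle : ∀ z ∈ y ::ₘ t, z ≤ y := by simpa using hyt
  have hrow : minSum (x ::ₘ s) (y ::ₘ t) = (y ::ₘ t).sum + minSum s (y ::ₘ t) := by
    rw [minSum_cons_left, sum_map_min_eq fun z hz => (hle z hz).trans hyx]
  by_cases h : ∃ z ∈ s, y ≤ z ∧ (x ∈ s ∨ y < z)
  · obtain ⟨z, hz, hyz, -⟩ := h
    left
    linarith [sum_le_minSum_of_mem hs' ht hz fun a ha => (hle a ha).trans hyz]
  · push Not at h
    have hx : x ∉ s := fun hx => (h x hx hyx).1 hx
    have hsy : ∀ z ∈ s, z ≤ y := fun z hz => by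
      by_contra! hlt
      exact absurd ((h z hz hlt.le).2) (not_le.mpr hlt)
    refine Or.inr ⟨hx, hsy, ?_⟩
    rw [hrow, minSum_comm s (y ::ₘ t), minSum_cons_left, sum_map_min_eq hsy, minSum_comm t s]
    ring

lemma minSum_lower_bounds {x y a b : ℝ} {s t : Multiset ℝ} (hs : ∀ z ∈ x ::ₘ s, 0 ≤ z)
    (ht : ∀ z ∈ y ::ₘ t, 0 ≤ z) (hxs : ∀ z ∈ s, z ≤ x) (hyt : ∀ z ∈ t, z ≤ y)
    (hx : x ∈ s ∨ x ≤ a) (hy : y ∈ t ∨ y ≤ b) (hba : b ≤ a) {A B F : ℝ}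
    (hA : A ≤ (x ::ₘ s).sum) (hB : B ≤ (y ::ₘ t).sum) (hF : minSum (x ::ₘ s) (y ::ₘ t) ≤ F) :
    2 * B ≤ F ∨ 2 * A ≤ F ∨ B + 2 * (A - a) ≤ F ∨ B + (A - a) + (B - b) ≤ F ∨
      A + (A - a) + (B - b) ≤ F ∨ A + 2 * (B - b) ≤ F := by
  have hs' : ∀ z ∈ s, 0 ≤ z := fun z hz => hs z (Multiset.mem_cons_of_mem hz)
  have ht' : ∀ z ∈ t, 0 ≤ z := fun z hz => ht z (Multiset.mem_cons_of_mem hz)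
  have hsum := min_sum_le_minSum hs' ht'
  have hAs := Multiset.sum_cons x s
  have hBt := Multiset.sum_cons y t
  rcases le_total y x with hyx | hxy
  · rcases minSum_cons_cons_cases hs ht hyt hyx with h | ⟨hxs', hsy, h⟩
    · left
      linarith
    · have hxa := hx.resolve_left hxs'
      rcases hy with hy | hy
      · have h1 := sum_le_minSum_of_mem ht' hs' hy hsy
        rw [minSum_comm] at h1
        right; right; left
        linarith
      · rcases min_le_iff.mp hsum with h1 | h1
        · right; right; left
          linarith
        · right; right; right; left
          linarith
  · rw [minSum_comm] at hF hsum
    rcases minSum_cons_cons_cases ht hs hxs hxy with h | ⟨hyt', htx, h⟩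
    · right; left
      linarith
    · have hyb := hy.resolve_left hyt'
      rcases min_le_iff.mp hsum with h1 | h1
      · right; right; right; right; left
        linarith
      · right; right; right; right; right
        linarith

/-- `-log` of the distance to `ξ`, truncated below at `0`. -/
noncomputable def logProximity (ξ : ℝ) (z : ℂ) : ℝ := -Real.log (min 1 ‖(ξ : ℂ) - z‖)

/-- The multiset of the proximities to `ξ` of the complex roots of `P`. -/
noncomputable def rootProximities (ξ : ℝ) (P : ℤ[X]) : Multiset ℝ :=
  (P.map (Int.castRingHom ℂ)).roots.map (logProximity ξ)

/-- The leading coefficient of `P` times the product of the `max 1 ‖ξ - z‖` over the roots. -/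
noncomputable def shiftedMahler (ξ : ℝ) (P : ℤ[X]) : ℝ :=
  |(P.leadingCoeff : ℝ)| *
    ((P.map (Int.castRingHom ℂ)).roots.map fun z => max 1 ‖(ξ : ℂ) - z‖).prod

lemma logProximity_nonneg (ξ : ℝ) (z : ℂ) : 0 ≤ logProximity ξ z := by
  rw [logProximity, neg_nonneg]
  exact Real.log_nonpos (by positivity) (min_le_left _ _)

lemma rootProximities_nonneg (ξ : ℝ) (P : ℤ[X]) : ∀ x ∈ rootProximities ξ P, 0 ≤ x := by
  intro x hx
  obtain ⟨z, -, rfl⟩ := Multiset.mem_map.mp hx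
  exact logProximity_nonneg ξ z

lemma leadingCoeff_map_castRingHom (P : ℤ[X]) :
    (P.map (Int.castRingHom ℂ)).leadingCoeff = (P.leadingCoeff : ℂ) := by
  rw [leadingCoeff_map_of_injective (Int.castRingHom ℂ).injective_int]
  rfl

lemma norm_eval_map_eq (P : ℤ[X]) (z : ℂ) :
    ‖(P.map (Int.castRingHom ℂ)).eval z‖ =
      |(P.leadingCoeff : ℝ)| * ((P.map (Int.castRingHom ℂ)).roots.map fun w => ‖z - w‖).prod := by
  rw [(IsAlgClosed.splits (P.map (Int.castRingHom ℂ))).eval_eq_prod_roots, norm_mul,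
    leadingCoeff_map_castRingHom, Complex.norm_intCast]
  congr 1
  exact (map_multiset_prod (normHom : ℂ →*₀ ℝ) _).trans (by rw [Multiset.map_map]; rfl)

lemma eval_map_ofReal (P : ℤ[X]) (x : ℝ) :
    (P.map (Int.castRingHom ℂ)).eval (x : ℂ) = ((aeval x P : ℝ) : ℂ) := by
  rw [eval_map, ← algebraMap_int_eq, ← aeval_def]
  exact aeval_algebraMap_apply ℂ x P

lemma norm_sub_pos_of_mem_roots {ξ : ℝ} (hξ : Transcendental ℚ ξ) {P : ℤ[X]} (hP : P ≠ 0) {z : ℂ}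
    (hz : z ∈ (P.map (Int.castRingHom ℂ)).roots) : 0 < ‖(ξ : ℂ) - z‖ := by
  rw [norm_pos_iff, sub_ne_zero]
  rintro rfl
  have h := (mem_roots'.mp hz).2
  rw [IsRoot.def, eval_map_ofReal, Complex.ofReal_eq_zero] at h
  exact aeval_ne_zero_of_transcendental hξ hP h

lemma one_le_abs_leadingCoeff {P : ℤ[X]} (hP : P ≠ 0) : 1 ≤ |(P.leadingCoeff : ℝ)| := by
  rw [← Int.cast_abs]
  exact_mod_cast Int.one_le_abs (leadingCoeff_ne_zero.mpr hP)

lemma log_multiset_prod {ι : Type*} (s : Multiset ι) (f : ι → ℝ) (h : ∀ i ∈ s, 0 < f i) :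
    Real.log (s.map f).prod = (s.map fun i => Real.log (f i)).sum := by
  rw [Real.log_multiset_prod, Multiset.map_map]
  · rfl
  · intro x hx
    obtain ⟨i, hi, rfl⟩ := Multiset.mem_map.mp hx
    exact (h i hi).ne'

lemma log_shiftedMahler {ξ : ℝ} {P : ℤ[X]} (hP : P ≠ 0) :
    Real.log (shiftedMahler ξ P) = Real.log |(P.leadingCoeff : ℝ)| +
      ((P.map (Int.castRingHom ℂ)).roots.map fun z => Real.log (max 1 ‖(ξ : ℂ) - z‖)).sum := by
  have hpos : ∀ z ∈ (P.map (Int.castRingHom ℂ)).roots, 0 < max 1 ‖(ξ : ℂ) - z‖ :=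
    fun z _ => lt_max_of_lt_left one_pos
  rw [shiftedMahler, Real.log_mul, log_multiset_prod _ _ hpos]
  · linarith [one_le_abs_leadingCoeff hP]
  · refine (Multiset.prod_pos fun x hx => ?_).ne'
    obtain ⟨i, hi, rfl⟩ := Multiset.mem_map.mp hx
    exact hpos i hi

lemma sum_rootProximities {ξ : ℝ} (hξ : Transcendental ℚ ξ) {P : ℤ[X]} (hP : P ≠ 0) :
    (rootProximities ξ P).sum = Real.log (shiftedMahler ξ P) - Real.log |aeval ξ P| := by
  have hpos := fun z hz => norm_sub_pos_of_mem_roots hξ hP (z := z) hz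
  have h1 : |aeval ξ P| = ‖(P.map (Int.castRingHom ℂ)).eval (ξ : ℂ)‖ := by
    rw [eval_map_ofReal, Complex.norm_real, Real.norm_eq_abs]
  rw [h1, norm_eval_map_eq, log_shiftedMahler hP, Real.log_mul, log_multiset_prod _ _ hpos,
    rootProximities, add_sub_add_left_eq_sub, eq_sub_iff_add_eq, ← Multiset.sum_map_add]
  · refine congrArg Multiset.sum (Multiset.map_congr rfl fun z hz => ?_)
    have := hpos z hz
    rcases le_total 1 ‖(ξ : ℂ) - z‖ with h | h <;> simp [logProximity, h]
  · linarith [one_le_abs_leadingCoeff hP]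
  · refine (Multiset.prod_pos fun x hx => ?_).ne'
    obtain ⟨i, hi, rfl⟩ := Multiset.mem_map.mp hx
    exact hpos i hi

lemma one_le_shiftedMahler {ξ : ℝ} {P : ℤ[X]} (hP : P ≠ 0) : 1 ≤ shiftedMahler ξ P := by
  refine one_le_mul_of_one_le_of_one_le (one_le_abs_leadingCoeff hP) (Multiset.one_le_prod ?_)
  intro x hx
  obtain ⟨i, hi, rfl⟩ := Multiset.mem_map.mp hx
  exact le_max_left _ _

lemma card_roots_map_le {n : ℕ} {P : ℤ[X]} (hn : P.natDegree ≤ n) :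
    Multiset.card (P.map (Int.castRingHom ℂ)).roots ≤ n :=
  (card_roots' _).trans (natDegree_map_le.trans hn)

lemma abs_leadingCoeff_mul_prod_le {n : ℕ} {P : ℤ[X]} (hn : P.natDegree ≤ n) {f g : ℂ → ℝ} {c : ℝ}
    (hf : ∀ z, 0 ≤ f z) (hg : ∀ z, 0 ≤ g z) (hc : 1 ≤ c) (h : ∀ z, f z ≤ c * g z) :
    |(P.leadingCoeff : ℝ)| * ((P.map (Int.castRingHom ℂ)).roots.map f).prod ≤
      c ^ n * (|(P.leadingCoeff : ℝ)| * ((P.map (Int.castRingHom ℂ)).roots.map g).prod) := by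
  have h1 : ((P.map (Int.castRingHom ℂ)).roots.map f).prod ≤
      ((P.map (Int.castRingHom ℂ)).roots.map fun z => c * g z).prod :=
    Multiset.prod_map_le_prod_map₀ _ _ (fun z _ => hf z) fun z _ => h z
  rw [Multiset.prod_map_mul, Multiset.map_const', Multiset.prod_replicate] at h1
  have h2 : 0 ≤ ((P.map (Int.castRingHom ℂ)).roots.map g).prod := by
    refine Multiset.prod_nonneg fun x hx => ?_
    obtain ⟨i, hi, rfl⟩ := Multiset.mem_map.mp hx
    exact hg i
  have h3 : c ^ Multiset.card (P.map (Int.castRingHom ℂ)).roots ≤ c ^ n :=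
    pow_le_pow_right₀ hc (card_roots_map_le hn)
  rw [mul_left_comm]
  gcongr
  exact h1.trans (by gcongr)

lemma intMahler_eq (P : ℤ[X]) : intMahler P =
    |(P.leadingCoeff : ℝ)| * ((P.map (Int.castRingHom ℂ)).roots.map fun z => max 1 ‖z‖).prod := by
  rw [intMahler, mahlerMeasure_eq_leadingCoeff_mul_prod_roots, leadingCoeff_map_castRingHom,
    Complex.norm_intCast]

lemma max_one_norm_sub_le (a z : ℂ) : max 1 ‖a - z‖ ≤ (1 + ‖a‖) * max 1 ‖z‖ := by
  have h1 : 1 ≤ max 1 ‖z‖ := le_max_left _ _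
  have h2 : ‖z‖ ≤ max 1 ‖z‖ := le_max_right _ _
  have h3 := norm_nonneg a
  have h4 := norm_sub_le a z
  refine max_le ?_ ?_ <;> nlinarith

lemma shiftedMahler_le {n : ℕ} (ξ : ℝ) {P : ℤ[X]} (hn : P.natDegree ≤ n) :
    shiftedMahler ξ P ≤ (1 + |ξ|) ^ n * intMahler P := by
  rw [intMahler_eq]
  refine abs_leadingCoeff_mul_prod_le hn (fun _ => by positivity) (fun _ => by positivity)
    (by linarith [abs_nonneg ξ]) fun z => ?_
  simpa using max_one_norm_sub_le (ξ : ℂ) z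

lemma intMahler_le_shiftedMahler {n : ℕ} (ξ : ℝ) {P : ℤ[X]} (hn : P.natDegree ≤ n) :
    intMahler P ≤ (1 + |ξ|) ^ n * shiftedMahler ξ P := by
  rw [intMahler_eq]
  refine abs_leadingCoeff_mul_prod_le hn (fun _ => by positivity) (fun _ => by positivity)
    (by linarith [abs_nonneg ξ]) fun z => ?_
  simpa using max_one_norm_sub_le (ξ : ℂ) ((ξ : ℂ) - z)

lemma exists_abs_log_shiftedMahler_sub_le (n : ℕ) (ξ : ℝ) :
    ∃ C : ℝ, 0 ≤ C ∧ ∀ P : ℤ[X], P ≠ 0 → P.natDegree ≤ n →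
      |Real.log (shiftedMahler ξ P) - Real.log (polyHeight P)| ≤ C := by
  have hξ : 1 ≤ 1 + |ξ| := by linarith [abs_nonneg ξ]
  have hξn : 1 ≤ (1 + |ξ|) ^ n := one_le_pow₀ hξ
  have h2n : (1 : ℝ) ≤ 2 ^ n := one_le_pow₀ (by norm_num)
  have hn1 : (1 : ℝ) ≤ n + 1 := by linarith [(Nat.cast_nonneg n : (0 : ℝ) ≤ n)]
  refine ⟨Real.log ((1 + |ξ|) ^ n) + Real.log (n + 1) + Real.log (2 ^ n), ?_, fun P hP hn => ?_⟩
  · linarith [Real.log_nonneg hξn, Real.log_nonneg h2n, Real.log_nonneg hn1]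
  have hH : 0 < polyHeight P := by linarith [one_le_polyHeight hP]
  have hM : 0 < intMahler P := by linarith [one_le_intMahler hP]
  have hS : 0 < shiftedMahler ξ P := by linarith [one_le_shiftedMahler (ξ := ξ) hP]
  have e1 := Real.log_le_log hS (shiftedMahler_le ξ hn)
  have e2 := Real.log_le_log hM (intMahler_le_polyHeight hn)
  have e3 := Real.log_le_log hM (intMahler_le_shiftedMahler ξ hn)
  have e4 := Real.log_le_log hH (polyHeight_le_intMahler hn)
  rw [Real.log_mul (by positivity) hM.ne'] at e1 e4
  rw [Real.log_mul (by positivity) hH.ne'] at e2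
  rw [Real.log_mul (by positivity) hS.ne'] at e3
  rw [abs_le]
  constructor <;> linarith [Real.log_nonneg hξn, Real.log_nonneg h2n, Real.log_nonneg hn1]

lemma isCoprime_map_of_irreducible {P Q : ℤ[X]} (hP : Irreducible P) (hd : P.natDegree ≠ 0)
    (hPQ : ¬ P ∣ Q) : IsCoprime (P.map (Int.castRingHom ℂ)) (Q.map (Int.castRingHom ℂ)) := by
  have hprim := hP.isPrimitive hd
  have h1 : IsCoprime (P.map (Int.castRingHom ℚ)) (Q.map (Int.castRingHom ℚ)) := by
    refine ((hprim.irreducible_iff_irreducible_map_fraction_map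
      (K := ℚ)).mp hP).coprime_iff_not_dvd.mpr fun h => hPQ ?_
    exact (IsPrimitive.Int.dvd_iff_map_cast_dvd_map_cast P Q hprim).mpr h
  have h2 := h1.map (mapRingHom (algebraMap ℚ ℂ))
  rwa [coe_mapRingHom, Polynomial.map_map, Polynomial.map_map,
    Subsingleton.elim ((algebraMap ℚ ℂ).comp (Int.castRingHom ℚ)) (Int.castRingHom ℂ)] at h2

lemma one_le_norm_prod_eval_roots {P Q : ℤ[X]} (hP : Irreducible P) (hd : P.natDegree ≠ 0)
    (hPQ : ¬ P ∣ Q) :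
    1 ≤ |(P.leadingCoeff : ℝ)| ^ Q.natDegree * ((P.map (Int.castRingHom ℂ)).roots.map
      fun z => ‖(Q.map (Int.castRingHom ℂ)).eval z‖).prod := by
  have hinj := (Int.castRingHom ℂ).injective_int
  have h1 := resultant_ne_zero _ _ (isCoprime_map_of_irreducible hP hd hPQ)
  have h2 := resultant_eq_prod_eval (P.map (Int.castRingHom ℂ)) (Q.map (Int.castRingHom ℂ))
    (Q.map (Int.castRingHom ℂ)).natDegree le_rfl (IsAlgClosed.splits _)
  have h3 := resultant_map_map P Q P.natDegree Q.natDegree (Int.castRingHom ℂ)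
  rw [natDegree_map_eq_of_injective hinj, natDegree_map_eq_of_injective hinj] at h1 h2
  have h4 : 1 ≤ ‖resultant (P.map (Int.castRingHom ℂ)) (Q.map (Int.castRingHom ℂ))
      P.natDegree Q.natDegree‖ := by
    rw [h3] at h1 ⊢
    rw [eq_intCast, Complex.norm_intCast, ← Int.cast_abs]
    exact_mod_cast Int.one_le_abs fun h => h1 (by simp [h])
  rw [h2, norm_mul, norm_pow, leadingCoeff_map_castRingHom, Complex.norm_intCast] at h4
  refine h4.trans_eq ?_
  congr 1
  exact (map_multiset_prod (normHom : ℂ →*₀ ℝ) _).trans (by rw [Multiset.map_map]; rfl)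

lemma norm_sub_le_exp_neg_min {ξ : ℝ} {z w : ℂ} (hz : 0 < ‖(ξ : ℂ) - z‖) (hw : 0 < ‖(ξ : ℂ) - w‖) :
    ‖z - w‖ ≤ 2 * max 1 ‖(ξ : ℂ) - z‖ * (max 1 ‖(ξ : ℂ) - w‖ *
      Real.exp (-min (logProximity ξ z) (logProximity ξ w))) := by
  have h : ‖z - w‖ ≤ ‖(ξ : ℂ) - z‖ + ‖(ξ : ℂ) - w‖ := by
    rw [show z - w = ((ξ : ℂ) - w) - ((ξ : ℂ) - z) by ring]
    linarith [norm_sub_le ((ξ : ℂ) - w) ((ξ : ℂ) - z)]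
  have hexp : ∀ {u : ℂ}, 0 < ‖(ξ : ℂ) - u‖ →
      Real.exp (-logProximity ξ u) = min 1 ‖(ξ : ℂ) - u‖ := fun hu => by
    rw [logProximity, neg_neg, Real.exp_log (lt_min one_pos hu)]
  have h1 : min 1 ‖(ξ : ℂ) - z‖ ≤ Real.exp (-min (logProximity ξ z) (logProximity ξ w)) := by
    rw [← hexp hz]
    exact Real.exp_le_exp.mpr (neg_le_neg (min_le_left _ _))
  have h2 : min 1 ‖(ξ : ℂ) - w‖ ≤ Real.exp (-min (logProximity ξ z) (logProximity ξ w)) := by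
    rw [← hexp hw]
    exact Real.exp_le_exp.mpr (neg_le_neg (min_le_right _ _))
  set E := Real.exp (-min (logProximity ξ z) (logProximity ξ w))
  have hE : 0 ≤ E := (Real.exp_pos _).le
  have hz1 : 1 ≤ max 1 ‖(ξ : ℂ) - z‖ := le_max_left _ _
  have hw1 : 1 ≤ max 1 ‖(ξ : ℂ) - w‖ := le_max_left _ _
  have hz2 : ‖(ξ : ℂ) - z‖ ≤ max 1 ‖(ξ : ℂ) - z‖ * E := by
    calc ‖(ξ : ℂ) - z‖ = max 1 ‖(ξ : ℂ) - z‖ * min 1 ‖(ξ : ℂ) - z‖ := by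
          rw [max_mul_min, one_mul]
      _ ≤ _ := mul_le_mul_of_nonneg_left h1 (by linarith)
  have hw2 : ‖(ξ : ℂ) - w‖ ≤ max 1 ‖(ξ : ℂ) - w‖ * E := by
    calc ‖(ξ : ℂ) - w‖ = max 1 ‖(ξ : ℂ) - w‖ * min 1 ‖(ξ : ℂ) - w‖ := by
          rw [max_mul_min, one_mul]
      _ ≤ _ := mul_le_mul_of_nonneg_left h2 (by linarith)
  have hz3 : max 1 ‖(ξ : ℂ) - z‖ * E ≤ max 1 ‖(ξ : ℂ) - z‖ * E * max 1 ‖(ξ : ℂ) - w‖ :=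
    le_mul_of_one_le_right (by positivity) hw1
  have hw3 : max 1 ‖(ξ : ℂ) - w‖ * E ≤ max 1 ‖(ξ : ℂ) - w‖ * E * max 1 ‖(ξ : ℂ) - z‖ :=
    le_mul_of_one_le_right (by positivity) hz1
  nlinarith

lemma prod_map_mul_exp_neg {ι : Type*} (s : Multiset ι) (c : ℝ) (f g : ι → ℝ) :
    (s.map fun i => c * (f i * Real.exp (-g i))).prod =
      c ^ Multiset.card s * ((s.map f).prod * Real.exp (-(s.map g).sum)) := by
  have h : (s.map fun i => Real.exp (-g i)).prod = Real.exp (-(s.map g).sum) := by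
    rw [← Multiset.sum_map_neg, Real.exp_multiset_sum, Multiset.map_map]
    rfl
  rw [Multiset.prod_map_mul, Multiset.prod_map_mul, Multiset.map_const', Multiset.prod_replicate, h]

lemma norm_eval_root_le {n : ℕ} {ξ : ℝ} (hξ : Transcendental ℚ ξ) {Q : ℤ[X]} (hQ : Q ≠ 0)
    (hQn : Q.natDegree ≤ n) {z : ℂ} (hz : 0 < ‖(ξ : ℂ) - z‖) :
    ‖(Q.map (Int.castRingHom ℂ)).eval z‖ ≤ 2 ^ n * shiftedMahler ξ Q *
      (max 1 ‖(ξ : ℂ) - z‖ ^ Q.natDegree * Real.exp (-((rootProximities ξ Q).map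
        fun y => min (logProximity ξ z) y).sum)) := by
  have h1 := Multiset.prod_map_le_prod_map₀ (s := (Q.map (Int.castRingHom ℂ)).roots)
    (fun w => ‖z - w‖) _ (fun _ _ => norm_nonneg _) fun w hw =>
      norm_sub_le_exp_neg_min hz (norm_sub_pos_of_mem_roots hξ hQ hw)
  rw [prod_map_mul_exp_neg] at h1
  have hz1 : 1 ≤ max 1 ‖(ξ : ℂ) - z‖ := le_max_left _ _
  have h2 : (2 * max 1 ‖(ξ : ℂ) - z‖) ^ Multiset.card (Q.map (Int.castRingHom ℂ)).roots ≤
      2 ^ n * max 1 ‖(ξ : ℂ) - z‖ ^ Q.natDegree := by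
    rw [mul_pow]
    have := card_roots_map_le (P := Q) le_rfl
    gcongr
    exacts [by norm_num, this.trans hQn]
  have h3 : 0 ≤ ((Q.map (Int.castRingHom ℂ)).roots.map fun w => max 1 ‖(ξ : ℂ) - w‖).prod := by
    refine Multiset.prod_nonneg fun x hx => ?_
    obtain ⟨i, -, rfl⟩ := Multiset.mem_map.mp hx
    positivity
  rw [norm_eval_map_eq, shiftedMahler, rootProximities, Multiset.map_map]
  calc _ ≤ |(Q.leadingCoeff : ℝ)| * (2 ^ n * max 1 ‖(ξ : ℂ) - z‖ ^ Q.natDegree * _) := by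
        gcongr
        refine h1.trans ?_
        gcongr
    _ = _ := by
        simp only [Function.comp_def]
        ring

/-- Liouville's inequality for a resultant, in terms of the proximities of the roots. -/
lemma minSum_rootProximities_le {n : ℕ} {ξ : ℝ} (hξ : Transcendental ℚ ξ) {P Q : ℤ[X]}
    (hP : Irreducible P) (hd : P.natDegree ≠ 0) (hPn : P.natDegree ≤ n) (hQ : Q ≠ 0)
    (hQn : Q.natDegree ≤ n) (hPQ : ¬ P ∣ Q) :
    minSum (rootProximities ξ P) (rootProximities ξ Q) ≤
      n * Real.log (shiftedMahler ξ P) + n * Real.log (shiftedMahler ξ Q) +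
        n * n * Real.log 2 := by
  have hA := one_le_shiftedMahler (ξ := ξ) hP.ne_zero
  have hB := one_le_shiftedMahler (ξ := ξ) hQ
  have h1 := Multiset.prod_map_le_prod_map₀ (s := (P.map (Int.castRingHom ℂ)).roots)
    (fun z => ‖(Q.map (Int.castRingHom ℂ)).eval z‖) _ (fun _ _ => norm_nonneg _) fun z hz =>
      norm_eval_root_le hξ hQ hQn (norm_sub_pos_of_mem_roots hξ hP.ne_zero hz)
  rw [prod_map_mul_exp_neg, Multiset.prod_map_pow] at h1
  have h2 := one_le_norm_prod_eval_roots hP hd hPQ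
  have h3 : (2 ^ n * shiftedMahler ξ Q) ^ Multiset.card (P.map (Int.castRingHom ℂ)).roots ≤
      (2 ^ n * shiftedMahler ξ Q) ^ n := by
    refine pow_le_pow_right₀ ?_ (card_roots_map_le hPn)
    exact one_le_mul_of_one_le_of_one_le (one_le_pow₀ (by norm_num)) hB
  have h4 : shiftedMahler ξ P ^ Q.natDegree ≤ shiftedMahler ξ P ^ n := pow_le_pow_right₀ hA hQn
  have h5 : 1 ≤ (2 ^ n * shiftedMahler ξ Q) ^ n * shiftedMahler ξ P ^ n *
      Real.exp (-minSum (rootProximities ξ P) (rootProximities ξ Q)) := by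
    refine (h2.trans (mul_le_mul_of_nonneg_left h1 (by positivity))).trans ?_
    rw [mul_left_comm, ← mul_assoc (|(P.leadingCoeff : ℝ)| ^ _), ← mul_pow, ← mul_assoc]
    have h6 : minSum (rootProximities ξ P) (rootProximities ξ Q) =
        ((P.map (Int.castRingHom ℂ)).roots.map fun z => ((rootProximities ξ Q).map
          fun y => min (logProximity ξ z) y).sum).sum := by
      rw [minSum]
      generalize rootProximities ξ Q = t
      rw [rootProximities, Multiset.map_map]
      rfl
    rw [h6]
    refine mul_le_mul_of_nonneg_right ?_ (Real.exp_pos _).le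
    exact mul_le_mul h3 h4 (by positivity) (by positivity)
  have h6 := Real.log_nonneg h5
  rw [Real.log_mul (by positivity) (by positivity), Real.log_exp,
    Real.log_mul (by positivity) (by positivity), Real.log_pow, Real.log_pow,
    Real.log_mul (by positivity) (by positivity), Real.log_pow] at h6
  linarith

lemma logProximity_conj (ξ : ℝ) (z : ℂ) :
    logProximity ξ (starRingEnd ℂ z) = logProximity ξ z := by
  rw [logProximity, logProximity, ← Complex.norm_conj, map_sub, Complex.conj_conj,
    Complex.conj_ofReal]

lemma conj_mem_roots {P : ℤ[X]} {z : ℂ} (hz : z ∈ (P.map (Int.castRingHom ℂ)).roots) :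
    starRingEnd ℂ z ∈ (P.map (Int.castRingHom ℂ)).roots := by
  rw [mem_roots', IsRoot.def, eval_map] at hz ⊢
  refine ⟨hz.1, ?_⟩
  have h := hom_eval₂ P (Int.castRingHom ℂ) (starRingEnd ℂ) z
  rwa [hz.2, map_zero, Subsingleton.elim ((starRingEnd ℂ).comp (Int.castRingHom ℂ))
    (Int.castRingHom ℂ), eq_comm] at h

lemma logProximity_le_of_irreducible_bound {n : ℕ} {ξ c X : ℝ} (hX : 0 ≤ X) (hc : 0 < c)
    (hc1 : c ≤ 1) (h : ∀ (α : ℝ) (Q : ℤ[X]), Irreducible Q → aeval α Q = 0 → Q.natDegree ≤ n →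
      c * (polyHeight Q) ^ (-X) ≤ |ξ - α|) {P : ℤ[X]} (hP : P ≠ 0) (hn : P.natDegree ≤ n) {α : ℝ}
    (hα : aeval α P = 0) :
    logProximity ξ α ≤ X * Real.log (polyHeight P) +
      (X * Real.log (2 ^ n * (n + 1)) - Real.log c) := by
  obtain ⟨Q, hQ, hQP, hQα⟩ := exists_irreducible_dvd_of_aeval_eq_zero hP hα
  have hH := one_le_polyHeight hP
  have hHQ := one_le_polyHeight hQ.ne_zero
  have hle := polyHeight_le_of_dvd hP hn hQP
  have h1 := h α Q hQ hQα ((natDegree_le_of_dvd hQP hP).trans hn)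
  have h2 : c * (polyHeight Q) ^ (-X) ≤ 1 :=
    mul_le_one₀ hc1 (by positivity) (Real.rpow_le_one_of_one_le_of_nonpos hHQ (by linarith))
  have h3 : 0 < c * (polyHeight Q) ^ (-X) := by positivity
  have h4 := Real.log_le_log h3 (le_min h2 h1)
  have h5 := Real.log_le_log (by linarith) hle
  rw [Real.log_mul hc.ne' (by positivity), Real.log_rpow (by linarith)] at h4
  rw [Real.log_mul (by positivity) (by linarith)] at h5
  rw [logProximity, ← Complex.ofReal_sub, Complex.norm_real, Real.norm_eq_abs]
  nlinarith

/-- The largest root proximity of `P` is either repeated or bounded by means of a lower bound for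
the distance of `ξ` to real algebraic numbers. -/
lemma exists_rootProximities_eq_cons {n : ℕ} {ξ c X : ℝ} (hX : 0 ≤ X) (hc : 0 < c)
    (hc1 : c ≤ 1) (h : ∀ (α : ℝ) (Q : ℤ[X]), Irreducible Q → aeval α Q = 0 → Q.natDegree ≤ n →
      c * (polyHeight Q) ^ (-X) ≤ |ξ - α|) {P : ℤ[X]} (hd : P.natDegree ≠ 0)
    (hn : P.natDegree ≤ n) :
    ∃ (x : ℝ) (s : Multiset ℝ), rootProximities ξ P = x ::ₘ s ∧ (∀ y ∈ s, y ≤ x) ∧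
      (x ∈ s ∨ x ≤ X * Real.log (polyHeight P) +
        (X * Real.log (2 ^ n * (n + 1)) - Real.log c)) := by
  have hP : P ≠ 0 := by
    rintro rfl
    exact hd natDegree_zero
  have hne : rootProximities ξ P ≠ 0 := by
    rw [rootProximities, Ne, Multiset.map_eq_zero, ← Multiset.card_eq_zero,
      ← (IsAlgClosed.splits _).natDegree_eq_card_roots,
      natDegree_map_eq_of_injective (Int.castRingHom ℂ).injective_int]
    exact hd
  obtain ⟨x, hx, hmax⟩ := exists_mem_forall_le hne
  obtain ⟨z, hz, rfl⟩ := Multiset.mem_map.mp hx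
  obtain ⟨t, ht⟩ := Multiset.exists_cons_of_mem hz
  have hcons : rootProximities ξ P = logProximity ξ z ::ₘ t.map (logProximity ξ) := by
    rw [rootProximities, ht, Multiset.map_cons]
  refine ⟨_, _, hcons, fun y hy => hmax y ?_, ?_⟩
  · rw [hcons]
    exact Multiset.mem_cons_of_mem hy
  by_cases hreal : starRingEnd ℂ z = z
  · right
    obtain ⟨α, rfl⟩ := Complex.conj_eq_iff_real.mp hreal
    have h0 := (mem_roots'.mp hz).2
    rw [IsRoot.def, eval_map_ofReal, Complex.ofReal_eq_zero] at h0
    exact logProximity_le_of_irreducible_bound hX hc hc1 h hP hn h0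
  · left
    have hmem := conj_mem_roots hz
    rw [ht, Multiset.mem_cons] at hmem
    exact Multiset.mem_map.mpr ⟨_, hmem.resolve_left hreal, logProximity_conj ξ z⟩

lemma one_le_abs_aeval_of_natDegree_eq_zero {P : ℤ[X]} (hP : P ≠ 0) (hd : P.natDegree = 0)
    (ξ : ℝ) : 1 ≤ |aeval ξ P| := by
  obtain ⟨a, rfl⟩ := natDegree_eq_zero.mp hd
  rw [aeval_C, algebraMap_int_eq, eq_intCast, ← Int.cast_abs]
  exact_mod_cast Int.one_le_abs (by simpa using hP)

lemma exists_abs_aeval_ge_of_irreducible {n : ℕ} {ξ : ℝ} (hξ : Transcendental ℚ ξ) {w B : ℝ}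
    (hw : 0 ≤ w) (h : ∀ P : ℤ[X], Irreducible P → P.natDegree ≤ n → B < polyHeight P →
      (polyHeight P) ^ (-w) < |aeval ξ P|) :
    ∃ c : ℝ, 0 < c ∧ c ≤ 1 ∧ ∀ P : ℤ[X], Irreducible P → P.natDegree ≤ n →
      c * (intMahler P) ^ (-w) ≤ |aeval ξ P| := by
  obtain ⟨R, hR⟩ := Set.exists_upper_bound_image _ (fun P : ℤ[X] => |aeval ξ P|⁻¹)
    (finite_polyHeight_le n B)
  obtain ⟨K, hK⟩ : ∃ K, ∀ P ∈ {P : ℤ[X] | P.natDegree ≤ n ∧ polyHeight P ≤ B}, |aeval ξ P|⁻¹ ≤ K :=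
    ⟨_, hR⟩
  have hK1 : 1 ≤ max 1 K := le_max_left _ _
  refine ⟨min (max 1 K)⁻¹ (((2 : ℝ) ^ n) ^ (-w)), by positivity,
    (min_le_left _ _).trans (inv_le_one_of_one_le₀ hK1), fun P hP hn => ?_⟩
  have hM := one_le_intMahler hP.ne_zero
  have hM0 : 0 < intMahler P := by linarith
  rcases le_or_gt (polyHeight P) B with hB | hB
  · have h0 : 0 < |aeval ξ P| := abs_pos.mpr (aeval_ne_zero_of_transcendental hξ hP.ne_zero)
    have h1 : |aeval ξ P|⁻¹ ≤ max 1 K := (hK P ⟨hn, hB⟩).trans (le_max_right _ _)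
    calc _ ≤ (max 1 K)⁻¹ * 1 := by
          gcongr
          exacts [min_le_left _ _, Real.rpow_le_one_of_one_le_of_nonpos hM (by linarith)]
      _ ≤ |aeval ξ P| := by
          rw [mul_one]
          exact inv_le_of_inv_le₀ h0 h1
  · have hH := one_le_polyHeight hP.ne_zero
    calc _ ≤ ((2 : ℝ) ^ n) ^ (-w) * (intMahler P) ^ (-w) := by
          gcongr
          exact min_le_right _ _
      _ = (2 ^ n * intMahler P) ^ (-w) := (Real.mul_rpow (by positivity) hM0.le).symm
      _ ≤ (polyHeight P) ^ (-w) :=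
          Real.rpow_le_rpow_of_nonpos (by linarith) (polyHeight_le_intMahler hn) (by linarith)
      _ ≤ _ := (h P hP hn hB).le

lemma exists_abs_aeval_ge {n : ℕ} {ξ w c : ℝ} (hw : 0 ≤ w) (hc : 0 < c) (hc1 : c ≤ 1)
    (h : ∀ P : ℤ[X], Irreducible P → P.natDegree ≤ n →
      c * (intMahler P) ^ (-w) ≤ |aeval ξ P|) {P : ℤ[X]} (hP : P ≠ 0) (hn : P.natDegree ≤ n) :
    c ^ P.natDegree * (intMahler P) ^ (-w) ≤ |aeval ξ P| := by
  have hle : ∀ {Q : ℤ[X]}, Q ≠ 0 → (intMahler Q) ^ (-w) ≤ 1 := fun hQ =>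
    Real.rpow_le_one_of_one_le_of_nonpos (one_le_intMahler hQ) (by linarith)
  have hdeg0 : ∀ {Q : ℤ[X]}, Q ≠ 0 → Q.natDegree = 0 →
      c ^ Q.natDegree * (intMahler Q) ^ (-w) ≤ |aeval ξ Q| := fun hQ hd => by
    rw [hd, pow_zero, one_mul]
    exact (hle hQ).trans (one_le_abs_aeval_of_natDegree_eq_zero hQ hd ξ)
  induction P using WfDvdMonoid.induction_on_irreducible with
  | zero => exact absurd rfl hP
  | unit u hu => exact hdeg0 hP (natDegree_eq_zero_of_isUnit hu)
  | mul a i ha hi ih =>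
    have hi0 := hi.ne_zero
    rw [natDegree_mul hi0 ha] at hn ⊢
    have h1 : c ^ i.natDegree * (intMahler i) ^ (-w) ≤ |aeval ξ i| := by
      rcases eq_or_ne i.natDegree 0 with hd | hd
      · exact hdeg0 hi0 hd
      · refine le_trans ?_ (h i hi (by omega))
        have h2 := one_le_intMahler hi0
        gcongr
        exact pow_le_of_le_one hc.le hc1 hd
    have h2 := ih ha (by omega)
    have hMa := one_le_intMahler ha
    have hMi := one_le_intMahler hi0
    rw [map_mul, abs_mul, intMahler_mul, Real.mul_rpow (by linarith) (by linarith), pow_add,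
      mul_mul_mul_comm]
    exact mul_le_mul h1 h2 (by positivity) (abs_nonneg _)

/-- Small values of polynomials are attained, up to an arbitrarily small loss in the exponent, by
irreducible polynomials. -/
lemma exists_irreducible_of_infinite {n : ℕ} {ξ : ℝ} (hξ : Transcendental ℚ ξ) {w w' : ℝ}
    (hw : 0 ≤ w) (hww' : w < w')
    (hinf : {P : ℤ[X] | P.natDegree ≤ n ∧ 0 < |aeval ξ P| ∧
      |aeval ξ P| ≤ (polyHeight P) ^ (-w')}.Infinite) (B : ℝ) :
    ∃ P : ℤ[X], Irreducible P ∧ P.natDegree ≤ n ∧ B < polyHeight P ∧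
      |aeval ξ P| ≤ (polyHeight P) ^ (-w) := by
  by_contra! hcon
  obtain ⟨c, hc, hc1, h⟩ := exists_abs_aeval_ge_of_irreducible hξ hw hcon
  obtain ⟨B', hB'⟩ := eventually_atTop.mp
    ((tendsto_rpow_atTop (sub_pos.mpr hww')).eventually_gt_atTop ((c ^ n)⁻¹ * ((n : ℝ) + 1) ^ w))
  refine hinf ((finite_polyHeight_le n B').subset fun P ⟨hn, h0, hle⟩ => ⟨hn, ?_⟩)
  have hP : P ≠ 0 := by
    rintro rfl
    simp at h0
  by_contra! hBP
  have h1 := hB' _ hBP.le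
  have h2 := (exists_abs_aeval_ge hw hc hc1 h hP hn).trans hle
  have hH := one_le_polyHeight hP
  have hM := one_le_intMahler hP
  have h3 : c ^ n * ((n + 1) * polyHeight P) ^ (-w) ≤ c ^ P.natDegree * (intMahler P) ^ (-w) := by
    refine mul_le_mul (pow_le_pow_of_le_one hc.le hc1 hn) ?_ (by positivity) (by positivity)
    exact Real.rpow_le_rpow_of_nonpos (by linarith) (intMahler_le_polyHeight hn) (by linarith)
  have h4 := h3.trans h2
  rw [Real.mul_rpow (by positivity) (by linarith), Real.rpow_neg (by positivity),
    Real.rpow_neg (by linarith), Real.rpow_neg (by linarith), ← mul_inv, ← div_eq_mul_inv,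
    div_le_iff₀ (by positivity), inv_mul_eq_div, le_div_iff₀ (by positivity)] at h4
  rw [Real.rpow_sub (by linarith), inv_mul_eq_div,
    div_lt_div_iff₀ (by positivity) (by positivity)] at h1
  linarith

lemma exists_irreducible_bound_of_finite {n : ℕ} {ξ s : ℝ} (hξ : Transcendental ℚ ξ) (hs : 0 ≤ s)
    (hfin : {α : ℝ | ∃ P : ℤ[X], Irreducible P ∧ aeval α P = 0 ∧
      P.natDegree ≤ n ∧ 0 < |ξ - α| ∧ |ξ - α| ≤ (polyHeight P) ^ (-s - 1)}.Finite) :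
    ∃ c : ℝ, 0 < c ∧ c ≤ 1 ∧ ∀ (α : ℝ) (Q : ℤ[X]), Irreducible Q → aeval α Q = 0 →
      Q.natDegree ≤ n → c * (polyHeight Q) ^ (-(s + 1)) ≤ |ξ - α| := by
  obtain ⟨β, hβ⟩ := Set.exists_upper_bound_image _ (fun α : ℝ => |ξ - α|⁻¹) hfin
  have hK1 : 1 ≤ max 1 |ξ - β|⁻¹ := le_max_left _ _
  refine ⟨(max 1 |ξ - β|⁻¹)⁻¹, by positivity, inv_le_one_of_one_le₀ hK1, fun α Q hQ hα hn => ?_⟩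
  have h0 := abs_sub_pos_of_transcendental hξ hQ.ne_zero hα
  have hH := one_le_polyHeight hQ.ne_zero
  rw [neg_add']
  rcases le_or_gt |ξ - α| ((polyHeight Q) ^ (-s - 1)) with h | h
  · have h1 := (hβ α ⟨Q, hQ, hα, hn, h0, h⟩).trans (le_max_right 1 _)
    refine (mul_le_of_le_one_right (by positivity) ?_).trans (inv_le_of_inv_le₀ h0 h1)
    exact Real.rpow_le_one_of_one_le_of_nonpos hH (by linarith)
  · exact (mul_le_of_le_one_left (by positivity) (inv_le_one_of_one_le₀ hK1)).trans h.le

lemma natDegree_ne_zero_of_abs_aeval_lt_one {P : ℤ[X]} {ξ : ℝ} (hP : P ≠ 0)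
    (h : |aeval ξ P| < 1) : P.natDegree ≠ 0 := fun hd =>
  absurd (one_le_abs_aeval_of_natDegree_eq_zero hP hd ξ) (not_le.mpr h)

lemma mul_le_of_minSum_cases {n s v w δ h k A B C₁ C₂ F₀ L F : ℝ} (hn : 2 ≤ n) (hs : 0 ≤ s)
    (hkh : k ≤ h) (hk : 0 ≤ k) (hC₁ : 0 ≤ C₁) (hC₂ : 0 ≤ C₂) (hL : 0 ≤ L)
    (h1 : δ ≤ 2 * v + 2 - 2 * n) (h2 : δ ≤ 2 * w + 2 - 2 * n)
    (h3 : δ ≤ v + 2 * w + 1 - 2 * n - 2 * s) (h4 : δ ≤ 2 * v + w + 1 - 2 * n - 2 * s)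
    (hA : (w + 1) * h - C₁ ≤ A) (hB : v * h + k - C₁ - L ≤ B) (hF : F ≤ n * h + n * k + F₀)
    (hcases : 2 * B ≤ F ∨ 2 * A ≤ F ∨ B + 2 * (A - ((s + 1) * h + C₂)) ≤ F ∨
      B + (A - ((s + 1) * h + C₂)) + (B - ((s + 1) * k + C₂)) ≤ F ∨
      A + (A - ((s + 1) * h + C₂)) + (B - ((s + 1) * k + C₂)) ≤ F ∨
      A + 2 * (B - ((s + 1) * k + C₂)) ≤ F) :
    δ * h ≤ F₀ + 3 * C₁ + 2 * L + 2 * C₂ := by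
  have hh : 0 ≤ h := hk.trans hkh
  have e0 : 0 ≤ (n - 2) * (h - k) := mul_nonneg (by linarith) (by linarith)
  have e1 := mul_le_mul_of_nonneg_right h1 hh
  have e2 := mul_le_mul_of_nonneg_right h2 hh
  have e3 := mul_le_mul_of_nonneg_right h3 hh
  have e4 := mul_le_mul_of_nonneg_right h4 hh
  have e5 : 0 ≤ s * (h - k) := mul_nonneg hs (by linarith)
  rcases hcases with h | h | h | h | h | h <;> nlinarith

/-- Lower bound for the approximation by algebraic numbers in terms of the ordinary and the uniform
exponents of polynomial approximation. -/
lemma le_of_finite_algebraic_approximation {n : ℕ} (hn : 2 ≤ n) {ξ : ℝ} (hξ : Transcendental ℚ ξ)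
    {s v w : ℝ} (hs : 0 ≤ s) (hv : (n : ℝ) - 1 < v) (hvw : v ≤ w)
    (hfin : {α : ℝ | ∃ P : ℤ[X], Irreducible P ∧ aeval α P = 0 ∧
      P.natDegree ≤ n ∧ 0 < |ξ - α| ∧ |ξ - α| ≤ (polyHeight P) ^ (-s - 1)}.Finite)
    (hunif : ∀ᶠ H : ℝ in atTop, ∃ P : ℤ[X], P.natDegree ≤ n ∧ polyHeight P ≤ H ∧
      0 < |aeval ξ P| ∧ |aeval ξ P| ≤ H ^ (-v))
    (hinf : {P : ℤ[X] | P.natDegree ≤ n ∧ 0 < |aeval ξ P| ∧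
      |aeval ξ P| ≤ (polyHeight P) ^ (-w)}.Infinite) :
    (w + 1) / 2 + v - n ≤ s := by
  by_contra! hlt
  have hn' : (2 : ℝ) ≤ n := by exact_mod_cast hn
  obtain ⟨u, hu, huw⟩ := exists_between (show max ((n : ℝ) - 1)
      (max (2 * s - 1 - 2 * v + 2 * n) ((2 * s - 1 - v + 2 * n) / 2)) < w by
    refine max_lt (by linarith) (max_lt (by linarith) (by linarith)))
  obtain ⟨hu1, hu⟩ := max_lt_iff.mp hu
  obtain ⟨hu2, hu3⟩ := max_lt_iff.mp hu
  obtain ⟨δ, hδ, h1, h2, h3, h4⟩ : ∃ δ : ℝ, 0 < δ ∧ δ ≤ 2 * v + 2 - 2 * n ∧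
      δ ≤ 2 * u + 2 - 2 * n ∧ δ ≤ v + 2 * u + 1 - 2 * n - 2 * s ∧
      δ ≤ 2 * v + u + 1 - 2 * n - 2 * s := by
    refine ⟨min (min (2 * v + 2 - 2 * n) (2 * u + 2 - 2 * n))
      (min (v + 2 * u + 1 - 2 * n - 2 * s) (2 * v + u + 1 - 2 * n - 2 * s)),
      lt_min (lt_min (by linarith) (by linarith)) (lt_min (by linarith) (by linarith)), ?_⟩
    simp
  obtain ⟨c, hc, hc1, hbound⟩ := exists_irreducible_bound_of_finite hξ hs hfin
  obtain ⟨C₁, hC₁, hlog⟩ := exists_abs_log_shiftedMahler_sub_le n ξ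
  obtain ⟨H₀, hH₀⟩ := eventually_atTop.mp hunif
  set E : ℝ := 2 ^ n * (n + 1) with hE
  have hE1 : 1 ≤ E := one_le_mul_of_one_le_of_one_le (one_le_pow₀ (by norm_num)) (by linarith)
  set C₂ : ℝ := (s + 1) * Real.log E - Real.log c with hC₂def
  have hC₂ : 0 ≤ C₂ := by
    have := mul_nonneg (by linarith : 0 ≤ s + 1) (Real.log_nonneg hE1)
    linarith [Real.log_nonpos hc.le hc1]
  set L : ℝ := v * Real.log (2 * E) with hLdef
  have hL : 0 ≤ L := mul_nonneg (by linarith) (Real.log_nonneg (by linarith))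
  set F₀ : ℝ := 2 * n * C₁ + n * n * Real.log 2 with hF₀
  obtain ⟨P, hP, hPn, hPB, hPξ⟩ := exists_irreducible_of_infinite hξ (by linarith) huw hinf
    (max (max 1 H₀ * (2 * E)) (Real.exp ((F₀ + 3 * C₁ + 2 * L + 2 * C₂) / δ)))
  obtain ⟨hPB, hPexp⟩ := max_lt_iff.mp hPB
  have hm1 : 1 ≤ max 1 H₀ := le_max_left _ _
  have hHP : 1 < polyHeight P :=
    (one_le_mul_of_one_le_of_one_le hm1 (by linarith)).trans_lt hPB
  have hdiv : max 1 H₀ < polyHeight P / (2 * E) := (lt_div_iff₀ (by linarith)).mpr hPB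
  have hdiv1 : 1 < polyHeight P / (2 * E) := hm1.trans_lt hdiv
  obtain ⟨Q, hQn, hQH, hQ0, hQξ⟩ := hH₀ (polyHeight P / (2 * E)) ((le_max_right _ _).trans hdiv.le)
  have hQ : Q ≠ 0 := by
    rintro rfl
    simp at hQ0
  have hHQ := one_le_polyHeight hQ
  have hPd : P.natDegree ≠ 0 := natDegree_ne_zero_of_abs_aeval_lt_one hP.ne_zero
    (hPξ.trans_lt (Real.rpow_lt_one_of_one_lt_of_neg hHP (by linarith)))
  have hQd : Q.natDegree ≠ 0 := natDegree_ne_zero_of_abs_aeval_lt_one hQ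
    (hQξ.trans_lt (Real.rpow_lt_one_of_one_lt_of_neg hdiv1 (by linarith)))
  have hQH' : polyHeight Q * (2 * E) ≤ polyHeight P := (le_div_iff₀ (by linarith)).mp hQH
  have hEQ : 1 ≤ E * polyHeight Q := one_le_mul_of_one_le_of_one_le hE1 hHQ
  have hPQ : ¬ P ∣ Q := fun hdvd => by
    have := polyHeight_le_of_dvd hQ hQn hdvd
    linarith
  have hQP : polyHeight Q ≤ polyHeight P :=
    (le_mul_of_one_le_right (by linarith) (by linarith)).trans hQH'
  have hP0 : 0 < |aeval ξ P| := abs_pos.mpr (aeval_ne_zero_of_transcendental hξ hP.ne_zero)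
  have hlogP := Real.log_le_log hP0 hPξ
  have hlogQ := Real.log_le_log hQ0 hQξ
  rw [Real.log_rpow (by linarith)] at hlogP hlogQ
  rw [Real.log_div (by linarith) (by linarith)] at hlogQ
  have hkh := Real.log_le_log (by linarith) hQP
  have hk := Real.log_nonneg hHQ
  obtain ⟨x, S, hxS, hSx, hx⟩ := exists_rootProximities_eq_cons (by linarith) hc hc1 hbound hPd hPn
  obtain ⟨y, T, hyT, hTy, hy⟩ := exists_rootProximities_eq_cons (by linarith) hc hc1 hbound hQd hQn
  have hsumP := sum_rootProximities hξ hP.ne_zero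
  have hsumQ := sum_rootProximities hξ hQ
  have hMP := abs_le.mp (hlog P hP.ne_zero hPn)
  have hMQ := abs_le.mp (hlog Q hQ hQn)
  have hmin := minSum_rootProximities_le hξ hP hPd hPn hQ hQn hPQ
  have hSnn := rootProximities_nonneg ξ P
  have hTnn := rootProximities_nonneg ξ Q
  rw [hxS] at hsumP hmin hSnn
  rw [hyT] at hsumQ hmin hTnn
  have hnP := mul_le_mul_of_nonneg_left hMP.2 (by linarith : (0 : ℝ) ≤ n)
  have hnQ := mul_le_mul_of_nonneg_left hMQ.2 (by linarith : (0 : ℝ) ≤ n)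
  have hcases := minSum_lower_bounds hSnn hTnn hSx hTy hx hy
    (by gcongr) le_rfl le_rfl hmin
  have hfinal := mul_le_of_minSum_cases (n := n) (v := v) (w := u) (L := L) (C₁ := C₁) (F₀ := F₀)
    hn' hs hkh hk hC₁ hC₂ hL h1 h2 h3 h4
    (by rw [hsumP]; linarith) (by rw [hsumQ]; linarith) (by linarith) hcases
  have hh := (Real.lt_log_iff_exp_lt (by linarith)).mpr hPexp
  rw [div_lt_iff₀ hδ] at hh
  linarith

lemma infinite_of_eventually {n : ℕ} {ξ v : ℝ} (hv : 0 < v)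
    (h : ∀ᶠ H : ℝ in atTop, ∃ P : ℤ[X], P.natDegree ≤ n ∧ polyHeight P ≤ H ∧
      0 < |aeval ξ P| ∧ |aeval ξ P| ≤ H ^ (-v)) :
    {P : ℤ[X] | P.natDegree ≤ n ∧ 0 < |aeval ξ P| ∧
      |aeval ξ P| ≤ (polyHeight P) ^ (-v)}.Infinite := by
  intro hfin
  obtain ⟨R, hR⟩ := Set.exists_upper_bound_image _ (fun P : ℤ[X] => |aeval ξ P|⁻¹) hfin
  have hlim := (tendsto_rpow_atTop hv).eventually_gt_atTop |aeval ξ R|⁻¹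
  obtain ⟨H, ⟨P, hn, hH, h0, hle⟩, hlt⟩ := (h.and hlim).exists
  have hP : P ≠ 0 := by
    rintro rfl
    simp at h0
  have hH1 := one_le_polyHeight hP
  have h1 := hR P ⟨hn, h0, hle.trans (Real.rpow_le_rpow_of_nonpos (by linarith) hH (by linarith))⟩
  rw [Real.rpow_neg (by linarith)] at hle
  have h2 := le_inv_of_le_inv₀ h0 hle
  linarith

lemma exists_abs_aeval_le_mul_abs_sub (n : ℕ) (ξ : ℝ) :
    ∃ C : ℝ, ∀ (P : ℤ[X]) (α : ℝ), P.natDegree ≤ n → aeval α P = 0 → |ξ - α| ≤ 1 →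
      |aeval ξ P| ≤ C * polyHeight P * |ξ - α| := by
  obtain ⟨C, hC, h⟩ := exists_taylor_bound n ξ
  refine ⟨C + ∑ i ∈ Finset.range (n + 1), |(i : ℝ) * ξ ^ (i - 1)|, fun P α hn hα hle => ?_⟩
  have h1 := h P hn (α - ξ) (by rwa [abs_sub_comm])
  rw [add_sub_cancel, hα] at h1
  have h2 : |aeval ξ (derivative P)| ≤
      polyHeight P * ∑ i ∈ Finset.range (n + 1), |(i : ℝ) * ξ ^ (i - 1)| := by
    rw [aeval_derivative_eq_sum (Nat.lt_succ_of_le hn), Finset.mul_sum]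
    refine (Finset.abs_sum_le_sum_abs _ _).trans (Finset.sum_le_sum fun i _ => ?_)
    rw [abs_mul]
    exact mul_le_mul_of_nonneg_right (abs_coeff_le_polyHeight P i) (abs_nonneg _)
  have hH := polyHeight_nonneg P
  rw [abs_sub_comm ξ α] at hle ⊢
  have h3 : (α - ξ) ^ 2 ≤ |α - ξ| := by
    rw [← sq_abs]
    exact pow_le_of_le_one (abs_nonneg _) hle two_ne_zero
  have h4 := mul_le_mul_of_nonneg_right h2 (abs_nonneg (α - ξ))
  have h5 := mul_le_mul_of_nonneg_left h3 (mul_nonneg hC hH)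
  rw [← abs_mul] at h4
  have h6 := abs_sub_abs_le_abs_sub (aeval ξ P) (-(aeval ξ (derivative P) * (α - ξ)))
  rw [abs_neg, abs_sub_comm] at h6
  have h7 : |aeval ξ P| - |aeval ξ (derivative P) * (α - ξ)| ≤ C * polyHeight P * (α - ξ) ^ 2 := by
    refine (h6.trans_eq ?_).trans h1
    congr 1
    ring
  linarith

/-- Good algebraic approximations give small values of polynomials. -/
lemma infinite_of_infinite_algebraic {n : ℕ} {ξ : ℝ} (hξ : Transcendental ℚ ξ) {w s : ℝ}
    (hs : 0 ≤ s) (hws : w < s)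
    (hinf : {α : ℝ | ∃ P : ℤ[X], Irreducible P ∧ aeval α P = 0 ∧
      P.natDegree ≤ n ∧ 0 < |ξ - α| ∧ |ξ - α| ≤ (polyHeight P) ^ (-s - 1)}.Infinite) :
    {P : ℤ[X] | P.natDegree ≤ n ∧ 0 < |aeval ξ P| ∧
      |aeval ξ P| ≤ (polyHeight P) ^ (-w)}.Infinite := by
  intro hfin
  obtain ⟨C, hC⟩ := exists_abs_aeval_le_mul_abs_sub n ξ
  obtain ⟨B, hB⟩ := eventually_atTop.mp
    ((tendsto_rpow_atTop (sub_pos.mpr hws)).eventually_ge_atTop C)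
  refine hinf (((hfin.union (finite_polyHeight_le n B)).biUnion
    fun P _ => P.rootSet_finite ℝ).subset ?_)
  rintro α ⟨P, hP, hα, hn, h0, hle⟩
  refine Set.mem_biUnion ?_ ((mem_rootSet_of_ne hP.ne_zero).mpr hα)
  by_cases hPB : polyHeight P ≤ B
  · exact Or.inr ⟨hn, hPB⟩
  left
  have hH := one_le_polyHeight hP.ne_zero
  have hH0 : 0 < polyHeight P := by linarith
  refine ⟨hn, abs_pos.mpr (aeval_ne_zero_of_transcendental hξ hP.ne_zero), ?_⟩
  have h1 := hC P α hn hα (hle.trans (Real.rpow_le_one_of_one_le_of_nonpos hH (by linarith)))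
  have h2 := hB _ (not_le.mp hPB).le
  calc |aeval ξ P| ≤ C * polyHeight P * |ξ - α| := h1
    _ ≤ (polyHeight P) ^ (s - w) * polyHeight P * (polyHeight P) ^ (-s - 1) := by gcongr
    _ = (polyHeight P) ^ (-w) := by
        rw [← Real.rpow_add_one hH0.ne', ← Real.rpow_add hH0]
        congr 1
        ring

lemma uniform_of_finite_algebraic {n : ℕ} (hn : 2 ≤ n) {ξ : ℝ} (hξ : Transcendental ℚ ξ)
    {s v : ℝ} (hs : 0 ≤ s) (hv : (n : ℝ) - 1 < v) (hsv : s * (v - n + 1) < v)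
    (hfin : {α : ℝ | ∃ P : ℤ[X], Irreducible P ∧ aeval α P = 0 ∧
      P.natDegree ≤ n ∧ 0 < |ξ - α| ∧ |ξ - α| ≤ (polyHeight P) ^ (-s - 1)}.Finite) :
    ∀ᶠ H : ℝ in atTop, ∃ P : ℤ[X], P.natDegree ≤ n ∧ polyHeight P ≤ H ∧
      0 < |aeval ξ P| ∧ |aeval ξ P| ≤ H ^ (-v) := by
  by_contra hno
  exact infinite_algebraic_approximation hn hξ hv hs hno hsv hfin

lemma mul_le_of_finite_algebraic {n : ℕ} (hn : 2 ≤ n) {ξ : ℝ} (hξ : Transcendental ℚ ξ)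
    {s w : ℝ} (hs : 1 < s)
    (hfin : {α : ℝ | ∃ P : ℤ[X], Irreducible P ∧ aeval α P = 0 ∧
      P.natDegree ≤ n ∧ 0 < |ξ - α| ∧ |ξ - α| ≤ (polyHeight P) ^ (-s - 1)}.Finite)
    (hinf : {P : ℤ[X] | P.natDegree ≤ n ∧ 0 < |aeval ξ P| ∧
      |aeval ξ P| ≤ (polyHeight P) ^ (-w)}.Infinite) :
    w * (s - 1) ≤ 2 * s ^ 2 - s - 2 * n + 1 := by
  have hn' : (2 : ℝ) ≤ n := by exact_mod_cast hn
  by_contra! hlt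
  obtain ⟨v, hv, hvs⟩ := exists_between
    (show max ((n : ℝ) - 1) (s + n - (w + 1) / 2) < s * (n - 1) / (s - 1) by
      refine max_lt ?_ ?_ <;> rw [lt_div_iff₀ (by linarith)] <;> nlinarith)
  obtain ⟨hv1, hv2⟩ := max_lt_iff.mp hv
  rw [lt_div_iff₀ (by linarith)] at hvs
  have hunif := uniform_of_finite_algebraic hn hξ (by linarith) hv1 (by linarith) hfin
  rcases le_total v w with hvw | hwv
  · linarith [le_of_finite_algebraic_approximation hn hξ (by linarith) hv1 hvw hfin hunif hinf]
  · linarith [le_of_finite_algebraic_approximation hn hξ (by linarith) hv1 le_rfl hfin hunif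
      (infinite_of_eventually (by linarith) hunif)]

lemma finite_of_wStarExp_lt {n : ℕ} {ξ s : ℝ} (h : wStarExp n ξ < s) :
    {α : ℝ | ∃ P : ℤ[X], Irreducible P ∧ aeval α P = 0 ∧
      P.natDegree ≤ n ∧ 0 < |ξ - α| ∧ |ξ - α| ≤ (polyHeight P) ^ (-s - 1)}.Finite := by
  by_contra hinf
  have hle : (s : EReal) ≤ wStarExp n ξ := le_sSup ⟨s, rfl, hinf⟩
  exact absurd hle (not_le.mpr h)

lemma le_of_infinite_of_wExp_le {n : ℕ} {ξ w : ℝ} (hw : wExp n ξ ≤ 2 * (n : EReal) - 1)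
    (hinf : {P : ℤ[X] | P.natDegree ≤ n ∧ 0 < |aeval ξ P| ∧
      |aeval ξ P| ≤ (polyHeight P) ^ (-w)}.Infinite) : w ≤ 2 * n - 1 := by
  have h : (w : EReal) ≤ wExp n ξ := le_sSup ⟨w, rfl, hinf⟩
  have hcast : 2 * (n : EReal) - 1 = ((2 * n - 1 : ℝ) : EReal) := by
    push_cast
    rfl
  exact EReal.coe_le_coe_iff.mp (hcast ▸ h.trans hw)

lemma wStarExp_le {n : ℕ} {ξ : ℝ} (hξ : Transcendental ℚ ξ)
    (hw : wExp n ξ ≤ 2 * (n : EReal) - 1) : wStarExp n ξ ≤ ((2 * n + 1 : ℝ) : EReal) := by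
  refine sSup_le ?_
  rintro _ ⟨s, rfl, hs⟩
  rw [EReal.coe_le_coe_iff]
  by_contra! hlt
  have hn : (0 : ℝ) ≤ n := Nat.cast_nonneg n
  have := le_of_infinite_of_wExp_le hw
    (infinite_of_infinite_algebraic hξ (w := 2 * n) (by linarith) (by linarith) hs)
  linarith

lemma le_wStarExp {n : ℕ} (hn : 2 ≤ n) {ξ : ℝ} (hξ : Transcendental ℚ ξ)
    (hw : wExp n ξ ≤ 2 * (n : EReal) - 1) : ((5 / 4 : ℝ) : EReal) ≤ wStarExp n ξ := by
  by_contra! hlt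
  have hn' : (2 : ℝ) ≤ n := by exact_mod_cast hn
  have hunif := uniform_of_finite_algebraic hn hξ (v := 2 * n) (by norm_num) (by linarith)
    (by linarith) (finite_of_wStarExp_lt hlt)
  linarith [le_of_infinite_of_wExp_le hw (infinite_of_eventually (by linarith) hunif)]

lemma exists_wStarExp_eq_coe {n : ℕ} (hn : 2 ≤ n) {ξ : ℝ} (hξ : Transcendental ℚ ξ)
    (hw : wExp n ξ ≤ 2 * (n : EReal) - 1) : ∃ σ : ℝ, wStarExp n ξ = σ ∧ 1 < σ := by
  have h1 := le_wStarExp hn hξ hw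
  have h2 := wStarExp_le hξ hw
  lift wStarExp n ξ to ℝ using
    ⟨(h2.trans_lt (EReal.coe_lt_top _)).ne, ((EReal.bot_lt_coe _).trans_le h1).ne'⟩ with σ
  exact ⟨σ, rfl, by linarith [EReal.coe_le_coe_iff.mp h1]⟩

lemma mul_le_of_wStarExp_eq {n : ℕ} (hn : 2 ≤ n) {ξ : ℝ} (hξ : Transcendental ℚ ξ) {σ w : ℝ}
    (hσ : wStarExp n ξ = σ) (hσ1 : 1 < σ)
    (hinf : {P : ℤ[X] | P.natDegree ≤ n ∧ 0 < |aeval ξ P| ∧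
      |aeval ξ P| ≤ (polyHeight P) ^ (-w)}.Infinite) :
    w * (σ - 1) ≤ 2 * σ ^ 2 - σ - 2 * n + 1 := by
  have hc : Continuous fun s : ℝ => 2 * s ^ 2 - s - 2 * n + 1 - w * (s - 1) := by fun_prop
  refine sub_nonneg.mp (ge_of_tendsto (hc.tendsto σ |>.mono_left
    (nhdsWithin_le_nhds (s := Set.Ioi σ))) ?_)
  filter_upwards [self_mem_nhdsWithin] with s hs
  refine sub_nonneg.mpr (mul_le_of_finite_algebraic hn hξ (hσ1.trans hs) (finite_of_wStarExp_lt ?_)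
    hinf)
  rw [hσ]
  exact EReal.coe_lt_coe_iff.mpr hs

lemma mul_lt_of_wStarExp_eq {n : ℕ} (hn : 2 ≤ n) {ξ : ℝ} (hξ : Transcendental ℚ ξ) {σ : ℝ}
    (hσ : wStarExp n ξ = σ) (hσ1 : 1 < σ) :
    (n - 1) * (σ - 1) < 2 * σ ^ 2 - σ - 2 * n + 1 := by
  have hn' : (2 : ℝ) ≤ n := by exact_mod_cast hn
  have hfin := finite_of_wStarExp_lt (n := n) (ξ := ξ) (s := σ + 1) (by
    rw [hσ]
    exact EReal.coe_lt_coe_iff.mpr (by linarith))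
  have hη : 0 < ((n : ℝ) - 1) / (2 * σ) := by
    apply div_pos <;> linarith
  have hησ : ((n : ℝ) - 1) / (2 * σ) * (2 * σ) = n - 1 := div_mul_cancel₀ _ (by linarith)
  have hunif := uniform_of_finite_algebraic hn hξ (v := n - 1 + ((n : ℝ) - 1) / (2 * σ))
    (by linarith) (by linarith) (by nlinarith) hfin
  have := mul_le_of_wStarExp_eq hn hξ hσ hσ1 (infinite_of_eventually (by linarith) hunif)
  nlinarith

theorem stmt15 (n : ℕ) (hn : 2 ≤ n) (ξ : ℝ) (hξ : Transcendental ℚ ξ)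
    (hw : wExp n ξ ≤ 2 * (n : EReal) - 1) :
    (2 * wStarExp n ξ ^ 2 - wStarExp n ξ - 2 * (n : EReal) + 1) /
        (2 * wStarExp n ξ ^ 2 - (n : EReal) * wStarExp n ξ - (n : EReal)) ≤
      whStarExp n ξ := by
  obtain ⟨σ, hσ, hσ1⟩ := exists_wStarExp_eq_coe hn hξ hw
  have hlt := mul_lt_of_wStarExp_eq hn hξ hσ hσ1
  have hcast : (2 * wStarExp n ξ ^ 2 - wStarExp n ξ - 2 * (n : EReal) + 1) /
      (2 * wStarExp n ξ ^ 2 - (n : EReal) * wStarExp n ξ - (n : EReal)) =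
        (((2 * σ ^ 2 - σ - 2 * n + 1) / (2 * σ ^ 2 - n * σ - n) : ℝ) : EReal) := by
    rw [hσ]
    rfl
  rw [hcast]
  refine EReal.ge_of_forall_gt_iff_ge.mp fun r hr => ?_
  rw [EReal.coe_lt_coe_iff, lt_div_iff₀ (by linarith)] at hr
  have hσ0 : 0 < σ - 1 := by linarith
  set A : ℝ := 2 * σ ^ 2 - σ - 2 * n + 1 with hA
  have hw0 : A / (σ - 1) * (σ - 1) = A := div_mul_cancel₀ _ hσ0.ne'
  have hc : Continuous fun w : ℝ => w - r * (w - n + 1) := by fun_prop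
  have hpos : 0 < A / (σ - 1) - r * (A / (σ - 1) - n + 1) := by
    refine (mul_pos_iff_of_pos_right hσ0).mp ?_
    have : (A / (σ - 1) - r * (A / (σ - 1) - n + 1)) * (σ - 1) =
        A - r * (2 * σ ^ 2 - n * σ - n) := by
      generalize A / (σ - 1) = q at hw0
      linear_combination (1 - r) * hw0 - r * hA
    linarith
  obtain ⟨w, hw1, hw2⟩ := (((hc.tendsto (A / (σ - 1))).eventually_const_lt hpos).filter_mono
    (nhdsWithin_le_nhds (s := Set.Ioi (A / (σ - 1)))) |>.and self_mem_nhdsWithin).exists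
  have hw2 : A / (σ - 1) < w := hw2
  have hnw : (n : ℝ) - 1 < w := ((lt_div_iff₀ hσ0).mpr hlt).trans hw2
  refine le_sSup ⟨r, rfl, eventually_algebraic_approximation hn hξ hnw ?_ (sub_pos.mp hw1)⟩
  by_contra hinf
  exact absurd (mul_le_of_wStarExp_eq hn hξ hσ hσ1 hinf) (not_le.mpr ((div_lt_iff₀ hσ0).mp hw2))
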